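/- Let r ∈ ℝ, T > 0, E > 0, and let β : ℝ → ℝ be twice continuously differentiable. Suppose V : (0,∞) × (0,T) → ℝ is sufficiently smooth (V is C¹ in t and C³ in S, with the mixed derivative ∂_t ∂²_S V continuous) and solves the nonlinear Black–Scholes equation ∂_t V(S,t) + S·β(S ∂²_S V(S,t)) + r S ∂_S V(S,t) − r V(S,t) = 0 for all S > 0, t ∈ (0,T). Define H(x,τ) = S ∂²_S V(S,t) with S = E e^x and t = T − τ. Then H solves the quasilinear Gamma equation ∂_τ H(x,τ) = ∂²_x [β(H(x,τ))] + ∂_x [β(H(x,τ))] + r ∂_x H(x,τ) for all x ∈ ℝ, τ ∈ (0,T). -/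

import Mathlib

open MeasureTheory Real Set
open Filter Topology Function

namespace GammaEquation

section

/-- Differentiation under the integral sign for a parametric primitive. -/
lemma hasDerivAt_integral_primitive {F : ℝ → ℝ → ℝ} (hF : Continuous (uncurry F)) (t S : ℝ) :
    HasDerivAt (fun S => ∫ τ in (0:ℝ)..t, ∫ z in (0:ℝ)..S, F z τ) (∫ τ in (0:ℝ)..t, F S τ) S := by
  have hswap : (fun S => ∫ τ in (0:ℝ)..t, ∫ z in (0:ℝ)..S, F z τ) =
      fun S => ∫ z in (0:ℝ)..S, ∫ τ in (0:ℝ)..t, F z τ := by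
    funext S
    refine intervalIntegral_intervalIntegral_swap (F := fun τ z => F z τ) ?_
    have hc : Continuous (uncurry fun τ z => F z τ) := hF.comp continuous_swap
    exact (hc.continuousOn.integrableOn_compact
      (isCompact_uIcc.prod isCompact_uIcc)).mono_set (prod_mono uIoc_subset_uIcc uIoc_subset_uIcc)
  rw [hswap]
  have hc : Continuous fun z => ∫ τ in (0:ℝ)..t, F z τ :=
    intervalIntegral.continuous_parametric_intervalIntegral_of_continuous' hF _ _
  exact intervalIntegral.integral_hasDerivAt_right (hc.intervalIntegrable _ _)
    (hc.stronglyMeasurableAtFilter _ _) hc.continuousAt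

lemma continuous_uncurry_primitive {F : ℝ → ℝ → ℝ} (hF : Continuous (uncurry F)) :
    Continuous (uncurry fun S t => ∫ z in (0:ℝ)..S, F z t) := by
  refine intervalIntegral.continuous_parametric_intervalIntegral_of_continuous
    (f := fun (q : ℝ × ℝ) z => F z q.2) ?_ continuous_fst
  exact hF.comp (by fun_prop : Continuous fun q : (ℝ × ℝ) × ℝ => (q.2, q.1.2))

lemma hasDerivAt_primitive {f : ℝ → ℝ} (hf : Continuous f) (x : ℝ) :
    HasDerivAt (fun x => ∫ z in (0:ℝ)..x, f z) (f x) x :=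
  intervalIntegral.integral_hasDerivAt_right (hf.intervalIntegrable _ _)
    (hf.stronglyMeasurableAtFilter _ _) hf.continuousAt

/-- A continuous function on a compact rectangle extends continuously to the plane. -/
lemma exists_continuous_extension {a b c d : ℝ} (hab : a ≤ b) (hcd : c ≤ d) {g : ℝ → ℝ → ℝ}
    (hg : ContinuousOn (uncurry g) (Icc a b ×ˢ Icc c d)) :
    ∃ γ : ℝ → ℝ → ℝ, Continuous (uncurry γ) ∧ ∀ x ∈ Icc a b, ∀ y ∈ Icc c d, γ x y = g x y := by
  refine ⟨fun x y => g (projIcc a b hab x) (projIcc c d hcd y), ?_, ?_⟩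
  · have h2 : Continuous fun q : ℝ × ℝ =>
        ((projIcc a b hab q.1 : ℝ), (projIcc c d hcd q.2 : ℝ)) := by fun_prop
    exact hg.comp_continuous h2 fun q => ⟨Subtype.prop _, Subtype.prop _⟩
  · intro x hx y hy
    simp only [projIcc_of_mem hab hx, projIcc_of_mem hcd hy]

/-- A function with vanishing second derivative is affine. -/
lemma affine_of_second_deriv_zero {c d : ℝ} {f f' : ℝ → ℝ}
    (h1 : ∀ x ∈ Ioo c d, HasDerivAt f (f' x) x) (h2 : ∀ x ∈ Ioo c d, HasDerivAt f' 0 x)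
    {x y z : ℝ} (hx : x ∈ Ioo c d) (hy : y ∈ Ioo c d) (hz : z ∈ Ioo c d) :
    f x * (z - y) = f y * (z - x) + f z * (x - y) := by
  have hconst : ∀ {k k' : ℝ → ℝ}, (∀ x ∈ Ioo c d, HasDerivAt k (k' x) x) →
      (∀ x ∈ Ioo c d, k' x = 0) → ∀ u ∈ Ioo c d, ∀ v ∈ Ioo c d, k u = k v := by
    intro k k' hk hk' u hu v hv
    refine (isOpen_Ioo.is_const_of_deriv_eq_zero isPreconnected_Ioo
      (fun w hw => (hk w hw).differentiableAt.differentiableWithinAt)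
      (fun w hw => ?_) hu hv)
    simpa [hk' w hw] using (hk w hw).deriv
  have e1 := hconst h2 (fun _ _ => rfl)
  have e2 := hconst (k := fun w => f w - f' x * w) (k' := fun w => f' w - f' x * 1)
    (fun w hw => (h1 w hw).sub ((hasDerivAt_id w).const_mul _))
    (fun w hw => by rw [e1 w hw x hx]; ring)
  have a1 := e2 x hx y hy
  have a2 := e2 x hx z hz
  linear_combination (z - x) * a1 + (x - y) * a2

/-- A function satisfying the three-point identity of affine functions has zero second
derivative. -/
lemma second_deriv_zero_of_affine {c d : ℝ} {f f' f'' : ℝ → ℝ}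
    (h1 : ∀ x ∈ Ioo c d, HasDerivAt f (f' x) x) (h2 : ∀ x ∈ Ioo c d, HasDerivAt f' (f'' x) x)
    (haff : ∀ x ∈ Ioo c d, ∀ y ∈ Ioo c d, ∀ z ∈ Ioo c d,
      f x * (z - y) = f y * (z - x) + f z * (x - y)) :
    ∀ x ∈ Ioo c d, f'' x = 0 := by
  intro x hx
  have hcd : c < d := hx.1.trans hx.2
  obtain ⟨y, hy⟩ := nonempty_Ioo.2 hcd
  obtain ⟨z, hz⟩ := nonempty_Ioo.2 hy.2
  have hz' : z ∈ Ioo c d := ⟨hy.1.trans hz.1, hz.2⟩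
  have hne : z - y ≠ 0 := by linarith [hz.1] |> fun h : 0 < z - y => h.ne'
  have hf' : ∀ u ∈ Ioo c d, f' u = (f z - f y) / (z - y) := by
    intro u hu
    have hd : HasDerivAt (fun u => (f y * (z - u) + f z * (u - y)) / (z - y))
        ((f y * (-1) + f z * 1) / (z - y)) u :=
      ((((hasDerivAt_id u).const_sub z).const_mul _).add
        (((hasDerivAt_id u).sub_const y).const_mul _)).div_const _
    have he : f =ᶠ[𝓝 u] fun u => (f y * (z - u) + f z * (u - y)) / (z - y) := by
      filter_upwards [isOpen_Ioo.mem_nhds hu] with w hw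
      rw [eq_div_iff hne, haff w hw y hy z hz']
    rw [(h1 u hu).unique (hd.congr_of_eventuallyEq he)]
    ring
  have he : f' =ᶠ[𝓝 x] fun _ => (f z - f y) / (z - y) := by
    filter_upwards [isOpen_Ioo.mem_nhds hx] with w hw using hf' w hw
  exact (h2 x hx).unique ((hasDerivAt_const x _).congr_of_eventuallyEq he)

/-- `V` solves the nonlinear Black–Scholes equation on `J × I`, where `p`, `h`, `l` are its first
three derivatives in `S` and `W` is its derivative in `t`; regularity is only assumed separately
in each variable. The formal derivative of `h` in `t` agrees with the continuous function `γ`. -/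
structure SeparateSolution (r : ℝ) (β : ℝ → ℝ) (V p h l W γ : ℝ → ℝ → ℝ) (J I : Set ℝ) :
    Prop where
  pos : ∀ S ∈ J, 0 < S
  V_S : ∀ S ∈ J, ∀ t ∈ I, HasDerivAt (fun S => V S t) (p S t) S
  p_S : ∀ S ∈ J, ∀ t ∈ I, HasDerivAt (fun S => p S t) (h S t) S
  h_S : ∀ S ∈ J, ∀ t ∈ I, HasDerivAt (fun S => h S t) (l S t) S
  l_cont : ∀ t ∈ I, ContinuousOn (fun S => l S t) J
  V_t : ∀ S ∈ J, ∀ t ∈ I, HasDerivAt (V S) (W S t) t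
  γ_cont : Continuous (uncurry γ)
  γ_eq : ∀ S ∈ J, ∀ t ∈ I, deriv (h S) t = γ S t
  pde : ∀ S ∈ J, ∀ t ∈ I, W S t = -(S * β (S * h S t)) - r * S * p S t + r * V S t

/-- The `S`-derivative of `∂ₜV`, computed from the equation. -/
noncomputable def flux (r : ℝ) (β : ℝ → ℝ) (h l : ℝ → ℝ → ℝ) (S t : ℝ) : ℝ :=
  -β (S * h S t) - S * (deriv β (S * h S t) * (h S t + S * l S t)) - r * S * h S t

variable {r : ℝ} {β : ℝ → ℝ} {V p h l W γ : ℝ → ℝ → ℝ} {J I : Set ℝ}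

/-- The part of `h` not explained by its formal time derivative. -/
noncomputable def defect (h γ : ℝ → ℝ → ℝ) (S t : ℝ) : ℝ := h S t - ∫ τ in (0:ℝ)..t, γ S τ

/-- `h` is the time primitive of its formal time derivative. -/
def DefectConstant (h γ : ℝ → ℝ → ℝ) (J I : Set ℝ) : Prop :=
  ∀ S ∈ J, ∀ s ∈ I, ∀ t ∈ I, defect h γ S s = defect h γ S t

/-- `V` corrected by the contribution of the formal time derivative of `h`. -/
noncomputable def reduced (V γ : ℝ → ℝ → ℝ) (S t : ℝ) : ℝ :=
  V S t - ∫ τ in (0:ℝ)..t, ∫ z in (0:ℝ)..S, ∫ y in (0:ℝ)..z, γ y τ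

namespace SeparateSolution

lemma mono (hs : SeparateSolution r β V p h l W γ J I) {J' I' : Set ℝ} (hJ : J' ⊆ J)
    (hI : I' ⊆ I) : SeparateSolution r β V p h l W γ J' I' where
  pos S hS := hs.pos S (hJ hS)
  V_S S hS t ht := hs.V_S S (hJ hS) t (hI ht)
  p_S S hS t ht := hs.p_S S (hJ hS) t (hI ht)
  h_S S hS t ht := hs.h_S S (hJ hS) t (hI ht)
  l_cont t ht := (hs.l_cont t (hI ht)).mono hJ
  V_t S hS t ht := hs.V_t S (hJ hS) t (hI ht)
  γ_cont := hs.γ_cont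
  γ_eq S hS t ht := hs.γ_eq S (hJ hS) t (hI ht)
  pde S hS t ht := hs.pde S (hJ hS) t (hI ht)

lemma hasDerivAt_W (hs : SeparateSolution r β V p h l W γ J I) (hβ : ContDiff ℝ 2 β)
    (hJ : IsOpen J) {S t : ℝ} (hS : S ∈ J) (ht : t ∈ I) :
    HasDerivAt (fun S => W S t) (flux r β h l S t) S := by
  have hb : HasDerivAt β (deriv β (S * h S t)) (S * h S t) :=
    (hβ.differentiable (by norm_num) _).hasDerivAt
  have hH : HasDerivAt (fun S => S * h S t) (1 * h S t + S * l S t) S :=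
    (hasDerivAt_id S).mul (hs.h_S S hS t ht)
  have hd := ((((hasDerivAt_id S).mul (hb.comp S hH)).neg.sub
    (((hasDerivAt_id S).const_mul r).mul (hs.p_S S hS t ht))).add
    ((hs.V_S S hS t ht).const_mul r))
  have he : (fun S => W S t) =ᶠ[𝓝 S] fun S =>
      -(S * β (S * h S t)) - r * S * p S t + r * V S t := by
    filter_upwards [hJ.mem_nhds hS] with w hw using hs.pde w hw t ht
  refine (hd.congr_of_eventuallyEq he).congr_deriv ?_
  simp only [flux, id, comp]
  ring

lemma hasDerivAt_reduced_S (hs : SeparateSolution r β V p h l W γ J I) {S t : ℝ} (hS : S ∈ J)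
    (ht : t ∈ I) : HasDerivAt (fun S => reduced V γ S t)
      (p S t - ∫ τ in (0:ℝ)..t, ∫ y in (0:ℝ)..S, γ y τ) S :=
  (hs.V_S S hS t ht).sub
    (hasDerivAt_integral_primitive (continuous_uncurry_primitive hs.γ_cont) t S)

lemma hasDerivAt_reduced_SS (hs : SeparateSolution r β V p h l W γ J I) {S t : ℝ} (hS : S ∈ J)
    (ht : t ∈ I) : HasDerivAt (fun S => p S t - ∫ τ in (0:ℝ)..t, ∫ y in (0:ℝ)..S, γ y τ)
      (defect h γ S t) S :=
  (hs.p_S S hS t ht).sub (hasDerivAt_integral_primitive hs.γ_cont t S)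

lemma hasDerivAt_reduced_t (hs : SeparateSolution r β V p h l W γ J I) {S t : ℝ} (hS : S ∈ J)
    (ht : t ∈ I) : HasDerivAt (reduced V γ S)
      (W S t - ∫ z in (0:ℝ)..S, ∫ y in (0:ℝ)..z, γ y t) t := by
  have hc := continuous_uncurry_primitive (continuous_uncurry_primitive hs.γ_cont)
  exact (hs.V_t S hS t ht).sub (hasDerivAt_primitive (hc.comp (Continuous.prodMk_right S)) t)

end SeparateSolution

lemma hasDerivAt_source_S (hγ : Continuous (uncurry γ)) (S t : ℝ) :
    HasDerivAt (fun S => ∫ z in (0:ℝ)..S, ∫ y in (0:ℝ)..z, γ y t) (∫ y in (0:ℝ)..S, γ y t) S :=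
  hasDerivAt_primitive ((continuous_uncurry_primitive hγ).comp (Continuous.prodMk_left t)) S

lemma hasDerivAt_source_SS (hγ : Continuous (uncurry γ)) (S t : ℝ) :
    HasDerivAt (fun S => ∫ y in (0:ℝ)..S, γ y t) (γ S t) S :=
  hasDerivAt_primitive (hγ.comp (Continuous.prodMk_left t)) S

lemma eq_of_hasDerivAt_zero {f : ℝ → ℝ} {u v : ℝ} (hf : ∀ t ∈ Ioo u v, HasDerivAt f 0 t) :
    ∀ s ∈ Ioo u v, ∀ t ∈ Ioo u v, f s = f t := fun _ hs' _ ht =>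
  isOpen_Ioo.is_const_of_deriv_eq_zero isPreconnected_Ioo
    (fun w hw => (hf w hw).differentiableAt.differentiableWithinAt)
    (fun w hw => (hf w hw).deriv) hs' ht

namespace SeparateSolution

variable {c d u v : ℝ}

/-- If the defect is constant in time, then `∂ₜV` has second `S`-derivative `γ`. -/
lemma hasDerivAt_flux_of_defectConstant
    (hs : SeparateSolution r β V p h l W γ (Ioo c d) (Ioo u v)) (hβ : ContDiff ℝ 2 β)
    (hd : DefectConstant h γ (Ioo c d) (Ioo u v)) :
    ∀ S ∈ Ioo c d, ∀ t ∈ Ioo u v, HasDerivAt (fun S => flux r β h l S t) (γ S t) S := by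
  intro S hS t ht
  have hcd : c < d := hS.1.trans hS.2
  set X : ℝ → ℝ → ℝ := fun S t => W S t - ∫ z in (0:ℝ)..S, ∫ y in (0:ℝ)..z, γ y t with hX
  have haff : ∀ x ∈ Ioo c d, ∀ y ∈ Ioo c d, ∀ z ∈ Ioo c d,
      X x t * (z - y) = X y t * (z - x) + X z t * (x - y) := by
    intro x hx y hy z hz
    set f : ℝ → ℝ := fun τ => reduced V γ x τ * (z - y) -
      (reduced V γ y τ * (z - x) + reduced V γ z τ * (x - y)) with hf
    have hconst : ∀ τ ∈ Ioo u v, f τ = f t := by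
      intro τ hτ
      have h0 := affine_of_second_deriv_zero (c := c) (d := d)
        (f := fun S => reduced V γ S τ - reduced V γ S t)
        (fun w hw => (hs.hasDerivAt_reduced_S hw hτ).sub (hs.hasDerivAt_reduced_S hw ht))
        (fun w hw => ((hs.hasDerivAt_reduced_SS hw hτ).sub
          (hs.hasDerivAt_reduced_SS hw ht)).congr_deriv (sub_eq_zero.2 (hd w hw τ hτ t ht)))
        hx hy hz
      simp only [hf]
      linear_combination h0
    have h1 : HasDerivAt f (X x t * (z - y) - (X y t * (z - x) + X z t * (x - y))) t :=
      ((hs.hasDerivAt_reduced_t hx ht).mul_const _).sub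
        (((hs.hasDerivAt_reduced_t hy ht).mul_const _).add
          ((hs.hasDerivAt_reduced_t hz ht).mul_const _))
    have h2 : HasDerivAt f 0 t := by
      refine (hasDerivAt_const t (f t)).congr_of_eventuallyEq ?_
      filter_upwards [isOpen_Ioo.mem_nhds ht] with τ hτ using hconst τ hτ
    exact sub_eq_zero.1 (h1.unique h2)
  obtain ⟨y, hy⟩ := nonempty_Ioo.2 hcd
  obtain ⟨z, hz⟩ := nonempty_Ioo.2 hy.2
  have hz' : z ∈ Ioo c d := ⟨hy.1.trans hz.1, hz.2⟩
  have hne : z - y ≠ 0 := (sub_pos.2 hz.1).ne'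
  have hflux : ∀ w ∈ Ioo c d, flux r β h l w t =
      (X z t - X y t) / (z - y) + ∫ y in (0:ℝ)..w, γ y t := by
    intro w hw
    have h1 : HasDerivAt (fun S => (X y t * (z - S) + X z t * (S - y)) / (z - y) +
        ∫ z in (0:ℝ)..S, ∫ y in (0:ℝ)..z, γ y t)
        ((X y t * (-1) + X z t * 1) / (z - y) + ∫ y in (0:ℝ)..w, γ y t) w :=
      (((((hasDerivAt_id w).const_sub z).const_mul _).add
        (((hasDerivAt_id w).sub_const y).const_mul _)).div_const _).add
        (hasDerivAt_source_S hs.γ_cont w t)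
    have he : (fun S => W S t) =ᶠ[𝓝 w] fun S => (X y t * (z - S) + X z t * (S - y)) / (z - y) +
        ∫ z in (0:ℝ)..S, ∫ y in (0:ℝ)..z, γ y t := by
      filter_upwards [isOpen_Ioo.mem_nhds hw] with x hx
      rw [← haff x hx y hy z hz', mul_div_cancel_right₀ _ hne]
      simp [hX]
    rw [(hs.hasDerivAt_W hβ isOpen_Ioo hw ht).unique (h1.congr_of_eventuallyEq he)]
    ring
  refine ((hasDerivAt_source_SS hs.γ_cont S t).const_add
    ((X z t - X y t) / (z - y))).congr_of_eventuallyEq ?_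
  filter_upwards [isOpen_Ioo.mem_nhds hS] with w hw using hflux w hw

/-- If `∂ₜV` has second `S`-derivative `γ`, then the defect is constant in time. -/
lemma defectConstant_of_hasDerivAt_flux
    (hs : SeparateSolution r β V p h l W γ (Ioo c d) (Ioo u v)) (hβ : ContDiff ℝ 2 β)
    (hQ : ∀ S ∈ Ioo c d, ∀ t ∈ Ioo u v, HasDerivAt (fun S => flux r β h l S t) (γ S t) S) :
    DefectConstant h γ (Ioo c d) (Ioo u v) := by
  intro S hS s hs' t ht
  have haff : ∀ x ∈ Ioo c d, ∀ y ∈ Ioo c d, ∀ z ∈ Ioo c d,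
      (reduced V γ x s - reduced V γ x t) * (z - y) =
        (reduced V γ y s - reduced V γ y t) * (z - x) +
        (reduced V γ z s - reduced V γ z t) * (x - y) := by
    intro x hx y hy z hz
    have h0 := eq_of_hasDerivAt_zero (u := u) (v := v)
      (f := fun τ => reduced V γ x τ * (z - y) -
      (reduced V γ y τ * (z - x) + reduced V γ z τ * (x - y))) (fun τ hτ => by
        refine (((hs.hasDerivAt_reduced_t hx hτ).mul_const _).sub
          (((hs.hasDerivAt_reduced_t hy hτ).mul_const _).add
          ((hs.hasDerivAt_reduced_t hz hτ).mul_const _))).congr_deriv ?_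
        rw [sub_eq_zero]
        refine affine_of_second_deriv_zero (c := c) (d := d)
          (f := fun S => W S τ - ∫ z in (0:ℝ)..S, ∫ y in (0:ℝ)..z, γ y τ)
          (fun w hw => (hs.hasDerivAt_W hβ isOpen_Ioo hw hτ).sub
            (hasDerivAt_source_S hs.γ_cont w τ))
          (fun w hw => ((hQ w hw τ hτ).sub
            (hasDerivAt_source_SS hs.γ_cont w τ)).congr_deriv (sub_self _)) hx hy hz) s hs' t ht
    linear_combination h0
  exact sub_eq_zero.1 (second_deriv_zero_of_affine
    (fun w hw => (hs.hasDerivAt_reduced_S hw hs').sub (hs.hasDerivAt_reduced_S hw ht))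
    (fun w hw => (hs.hasDerivAt_reduced_SS hw hs').sub (hs.hasDerivAt_reduced_SS hw ht))
    haff S hS)

end SeparateSolution

end

section

lemma exists_deriv_eq_sub {f f' : ℝ → ℝ} {a b : ℝ} (hab : a < b)
    (h : ∀ x ∈ Icc a b, HasDerivAt f (f' x) x) :
    ∃ ξ ∈ Ioo a b, f b - f a = f' ξ * (b - a) := by
  obtain ⟨ξ, hξ, he⟩ := exists_hasDerivAt_eq_slope f f' hab
    (fun x hx => (h x hx).continuousAt.continuousWithinAt)
    (fun x hx => h x (Ioo_subset_Icc_self hx))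
  exact ⟨ξ, hξ, by rw [he, div_mul_cancel₀ _ (sub_pos.2 hab).ne']⟩

lemma abs_sub_le_of_deriv_bound {f f' : ℝ → ℝ} {s : Set ℝ} (hs : Convex ℝ s) {M : ℝ}
    (h : ∀ x ∈ s, HasDerivAt f (f' x) x) (hM : ∀ x ∈ s, |f' x| ≤ M) {x y : ℝ} (hx : x ∈ s)
    (hy : y ∈ s) : |f y - f x| ≤ M * |y - x| :=
  hs.norm_image_sub_le_of_norm_hasDerivWithin_le (fun z hz => (h z hz).hasDerivWithinAt) hM hx hy

/-- The mean value theorem for second differences. -/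
lemma exists_second_difference_eq {f f' f'' : ℝ → ℝ} {x e : ℝ} (he : 0 < e)
    (h1 : ∀ y ∈ Icc (x - e) (x + e), HasDerivAt f (f' y) y)
    (h2 : ∀ y ∈ Icc (x - e) (x + e), HasDerivAt f' (f'' y) y) :
    ∃ ξ ∈ Ioo (x - e) (x + e), f (x + e) - 2 * f x + f (x - e) = e ^ 2 * f'' ξ := by
  obtain ⟨η, hη, e1⟩ := exists_deriv_eq_sub (f := fun y => f (y + e) - f y)
    (f' := fun y => f' (y + e) - f' y) (a := x - e) (b := x) (by linarith) (fun y hy =>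
      ((h1 (y + e) ⟨by linarith [hy.1], by linarith [hy.2]⟩).comp_add_const y e).sub
        (h1 y ⟨by linarith [hy.1], by linarith [hy.2]⟩))
  obtain ⟨ξ, hξ, e2⟩ := exists_deriv_eq_sub (f := f') (f' := f'') (a := η) (b := η + e)
    (by linarith) (fun y hy => h2 y ⟨by linarith [hy.1, hη.1], by linarith [hy.2, hη.2]⟩)
  refine ⟨ξ, ⟨by linarith [hξ.1, hη.1], by linarith [hξ.2, hη.2]⟩, ?_⟩
  simp only [sub_add_cancel] at e1
  rw [e2] at e1
  linear_combination e1

/-- A function whose `S`-sections are equicontinuous and whose `t`-sections are approximated by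
continuous functions is jointly continuous. -/
lemma continuousOn_of_approx {J I : Set ℝ} {k : ℝ → ℝ → ℝ}
    (happ : ∀ S ∈ J, ∀ t ∈ I, ∀ ε > 0, ∃ m : ℝ → ℝ, ContinuousWithinAt m I t ∧
      ∀ᶠ q in 𝓝[J ×ˢ I] (S, t), |k q.1 q.2 - m q.2| ≤ ε) :
    ContinuousOn (uncurry k) (J ×ˢ I) := by
  rintro ⟨S, t⟩ ⟨hS, ht⟩
  rw [ContinuousWithinAt, Metric.tendsto_nhds]
  intro ε hε
  obtain ⟨m, hm, hk⟩ := happ S hS t ht (ε / 4) (by positivity)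
  have h1 : ∀ᶠ q : ℝ × ℝ in 𝓝[J ×ˢ I] (S, t), dist (m q.2) (m t) < ε / 4 := by
    have : Tendsto (fun q : ℝ × ℝ => q.2) (𝓝[J ×ˢ I] (S, t)) (𝓝[I] t) := by
      rw [nhdsWithin_prod_eq]; exact tendsto_snd
    exact this.eventually ((Metric.tendsto_nhds.1 hm) (ε / 4) (by positivity))
  have h2 := hk.self_of_nhdsWithin (mk_mem_prod hS ht)
  filter_upwards [h1, hk] with q hq1 hq2
  rw [Real.dist_eq, abs_lt] at hq1 ⊢
  rw [abs_le] at hq2 h2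
  simp only [uncurry] at *
  constructor <;> linarith [hq1.1, hq1.2, hq2.1, hq2.2, h2.1, h2.2]

/-- If `f` is continuous in `t` and its second `S`-derivative `k` is equicontinuous in `S`, then
`k` is jointly continuous. -/
lemma continuousOn_of_equicontinuous {c d : ℝ} {I : Set ℝ} {f f' k : ℝ → ℝ → ℝ}
    (h1 : ∀ S ∈ Ioo c d, ∀ t ∈ I, HasDerivAt (fun S => f S t) (f' S t) S)
    (h2 : ∀ S ∈ Ioo c d, ∀ t ∈ I, HasDerivAt (fun S => f' S t) (k S t) S)
    (hf : ∀ S ∈ Ioo c d, ContinuousOn (f S) I)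
    (heq : ∀ ε > 0, ∃ δ > 0, ∀ t ∈ I, ∀ S ∈ Ioo c d, ∀ S' ∈ Ioo c d, |S - S'| < δ →
      |k S t - k S' t| ≤ ε) :
    ContinuousOn (uncurry k) (Ioo c d ×ˢ I) := by
  refine continuousOn_of_approx fun S hS t ht ε hε => ?_
  obtain ⟨δ, hδ, hk⟩ := heq (ε / 2) (by positivity)
  obtain ⟨e, he, hec, hed, heδ⟩ : ∃ e > 0, c < S - e ∧ S + e < d ∧ e < δ := by
    have hm : 0 < min δ (min (S - c) (d - S)) :=
      lt_min hδ (lt_min (sub_pos.2 hS.1) (sub_pos.2 hS.2))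
    have b1 := min_le_left δ (min (S - c) (d - S))
    have b2 := (min_le_right δ (min (S - c) (d - S))).trans (min_le_left _ _)
    have b3 := (min_le_right δ (min (S - c) (d - S))).trans (min_le_right _ _)
    exact ⟨min δ (min (S - c) (d - S)) / 2, by linarith, by linarith, by linarith, by linarith⟩
  have hmem : ∀ y ∈ Icc (S - e) (S + e), y ∈ Ioo c d := fun y hy =>
    ⟨by linarith [hy.1], by linarith [hy.2]⟩
  refine ⟨fun t => (f (S + e) t - 2 * f S t + f (S - e) t) / e ^ 2, ?_, ?_⟩
  · have a1 := hf (S + e) (hmem _ ⟨by linarith, le_rfl⟩) t ht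
    have a2 := hf S hS t ht
    have a3 := hf (S - e) (hmem _ ⟨le_rfl, by linarith⟩) t ht
    exact ((a1.sub (a2.const_mul 2)).add a3).div_const _
  · have hnhds : ∀ᶠ q : ℝ × ℝ in 𝓝[Ioo c d ×ˢ I] (S, t), |q.1 - S| < δ := by
      have : Tendsto (fun q : ℝ × ℝ => q.1) (𝓝[Ioo c d ×ˢ I] (S, t)) (𝓝 S) :=
        (continuous_fst.tendsto (S, t)).mono_left nhdsWithin_le_nhds
      have h3 := Metric.tendsto_nhds.1 this δ hδ
      simpa [Real.dist_eq] using h3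
    filter_upwards [hnhds, self_mem_nhdsWithin] with q hq hqm
    obtain ⟨ξ, hξ, e1⟩ := exists_second_difference_eq (f := fun y => f y q.2)
      (f' := fun y => f' y q.2) (f'' := fun y => k y q.2) (x := S) he
      (fun y hy => h1 y (hmem y hy) _ hqm.2) (fun y hy => h2 y (hmem y hy) _ hqm.2)
    have e2 : (f (S + e) q.2 - 2 * f S q.2 + f (S - e) q.2) / e ^ 2 = k ξ q.2 := by
      rw [e1]; field_simp
    rw [e2]
    have b1 := hk q.2 hqm.2 q.1 hqm.1 S hS hq
    have b2 := hk q.2 hqm.2 S hS ξ (hmem ξ (Ioo_subset_Icc_self hξ))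
      (by rw [abs_lt]; constructor <;> linarith [hξ.1, hξ.2])
    rw [abs_le] at *
    constructor <;> linarith [b1.1, b1.2, b2.1, b2.2]

lemma exists_rect_subset {s : Set (ℝ × ℝ)} {x y : ℝ} (hs : s ∈ 𝓝 (x, y)) :
    ∃ ρ > 0, Icc (x - ρ) (x + ρ) ×ˢ Icc (y - ρ) (y + ρ) ⊆ s := by
  obtain ⟨ρ, hρ, h⟩ := Metric.nhds_basis_closedBall.mem_iff.1 hs
  refine ⟨ρ, hρ, ?_⟩
  rw [← Real.closedBall_eq_Icc, ← Real.closedBall_eq_Icc, closedBall_prod_same]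
  exact h

/-- If `f` is continuous in `t` and its second `S`-derivative is jointly continuous, then `f` and
its first `S`-derivative are jointly continuous. -/
lemma continuousOn_of_continuousOn_second {J I : Set ℝ} (hJ : IsOpen J) (hI : IsOpen I)
    {f f' k : ℝ → ℝ → ℝ}
    (h1 : ∀ S ∈ J, ∀ t ∈ I, HasDerivAt (fun S => f S t) (f' S t) S)
    (h2 : ∀ S ∈ J, ∀ t ∈ I, HasDerivAt (fun S => f' S t) (k S t) S)
    (hf : ∀ S ∈ J, ContinuousOn (f S) I) (hk : ContinuousOn (uncurry k) (J ×ˢ I)) :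
    ContinuousOn (uncurry f') (J ×ˢ I) ∧ ContinuousOn (uncurry f) (J ×ˢ I) := by
  have key : ∀ {F F' : ℝ → ℝ → ℝ},
      (∀ S ∈ J, ∀ t ∈ I, HasDerivAt (fun S => F S t) (F' S t) S) →
      (∀ S ∈ J, ContinuousOn (F S) I) →
      (∀ S ∈ J, ∀ t ∈ I, ∃ M, ∀ᶠ q in 𝓝 (S, t), |F' q.1 q.2| ≤ M) →
      ContinuousOn (uncurry F) (J ×ˢ I) := by
    intro F F' hF hFt hM
    refine continuousOn_of_approx fun S hS t ht ε hε => ⟨F S, hFt S hS t ht, ?_⟩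
    obtain ⟨M, hM⟩ := hM S hS t ht
    obtain ⟨ρ, hρ, hsub⟩ := exists_rect_subset (inter_mem hM
      ((hJ.prod hI).mem_nhds (mk_mem_prod hS ht)))
    have hM0 : 0 ≤ M := (abs_nonneg _).trans hM.self_of_nhds
    have hη : 0 < min ρ (ε / (M + 1)) := lt_min hρ (by positivity)
    have hn : Ioo (S - min ρ (ε / (M + 1))) (S + min ρ (ε / (M + 1))) ×ˢ Ioo (t - ρ) (t + ρ)
        ∈ 𝓝 (S, t) := prod_mem_nhds (Ioo_mem_nhds (by linarith) (by linarith))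
          (Ioo_mem_nhds (by linarith) (by linarith))
    filter_upwards [nhdsWithin_le_nhds hn] with q hq
    have hq2 : q.2 ∈ Icc (t - ρ) (t + ρ) := Ioo_subset_Icc_self hq.2
    have hb := abs_sub_le_of_deriv_bound (f := fun S => F S q.2) (f' := fun S => F' S q.2)
      (convex_Icc (S - ρ) (S + ρ)) (M := M)
      (fun x hx => hF x (hsub (mk_mem_prod hx hq2)).2.1 _ (hsub (mk_mem_prod hx hq2)).2.2)
      (fun x hx => (hsub (mk_mem_prod hx hq2)).1) (x := S) (y := q.1)
      ⟨by linarith, by linarith⟩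
      ⟨by linarith [hq.1.1, min_le_left ρ (ε / (M + 1))],
        by linarith [hq.1.2, min_le_left ρ (ε / (M + 1))]⟩
    refine hb.trans ?_
    have h3 : |q.1 - S| ≤ ε / (M + 1) := by
      rw [abs_le]
      constructor <;> linarith [hq.1.1, hq.1.2, min_le_right ρ (ε / (M + 1))]
    calc M * |q.1 - S| ≤ (M + 1) * (ε / (M + 1)) := by gcongr; linarith
      _ = ε := by field_simp
  have bdd : ∀ {F : ℝ → ℝ → ℝ}, ContinuousOn (uncurry F) (J ×ˢ I) →
      ∀ S ∈ J, ∀ t ∈ I, ∃ M, ∀ᶠ q in 𝓝 (S, t), |F q.1 q.2| ≤ M := by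
    intro F hF S hS t ht
    have hc := (hF.continuousAt ((hJ.prod hI).mem_nhds (mk_mem_prod hS ht))).abs
    refine ⟨|F S t| + 1, ?_⟩
    filter_upwards [hc.eventually (gt_mem_nhds (lt_add_one _))] with q hq using hq.le
  have hf' : ContinuousOn (uncurry f') (J ×ˢ I) := by
    refine key h2 (fun S hS => ?_) (bdd hk)
    have h3 : ContinuousOn (uncurry fun (_ : ℝ) t => f' S t) (univ ×ˢ I) := by
      refine continuousOn_of_approx fun x _ t ht ε hε => ?_
      obtain ⟨M, hM⟩ := bdd hk S hS t ht
      obtain ⟨ρ, hρ, hsub⟩ := exists_rect_subset (inter_mem hM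
        ((hJ.prod hI).mem_nhds (mk_mem_prod hS ht)))
      have hM0 : 0 ≤ M := (abs_nonneg _).trans hM.self_of_nhds
      set e := min ρ (ε / (M + 1)) with he
      have hη : 0 < e := lt_min hρ (by positivity)
      have heρ : e ≤ ρ := min_le_left _ _
      have hSe : S + e ∈ J := (hsub (mk_mem_prod (a := S + e) (b := t) ⟨by linarith, by linarith⟩
        ⟨by linarith, by linarith⟩)).2.1
      refine ⟨fun t => (f (S + e) t - f S t) / e,
        ((hf _ hSe t ht).sub (hf S hS t ht)).div_const _, ?_⟩
      have hn : univ ×ˢ Ioo (t - ρ) (t + ρ) ∈ 𝓝 (x, t) :=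
        prod_mem_nhds univ_mem (Ioo_mem_nhds (by linarith) (by linarith))
      filter_upwards [nhdsWithin_le_nhds hn] with q hq
      have hq2 : q.2 ∈ Icc (t - ρ) (t + ρ) := Ioo_subset_Icc_self hq.2
      have hmem : ∀ y ∈ Icc S (S + e), y ∈ Icc (S - ρ) (S + ρ) := fun y hy =>
        ⟨by linarith [hy.1], by linarith [hy.2]⟩
      obtain ⟨ξ, hξ, e1⟩ := exists_deriv_eq_sub (f := fun S => f S q.2)
        (f' := fun S => f' S q.2) (a := S) (b := S + e) (by linarith)
        (fun y hy => h1 y (hsub (mk_mem_prod (hmem y hy) hq2)).2.1 _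
          (hsub (mk_mem_prod (hmem y hy) hq2)).2.2)
      have e2 : (f (S + e) q.2 - f S q.2) / e = f' ξ q.2 := by
        rw [e1]; field_simp; ring
      rw [e2]
      have hb := abs_sub_le_of_deriv_bound (f := fun S => f' S q.2) (f' := fun S => k S q.2)
        (convex_Icc (S - ρ) (S + ρ)) (M := M)
        (fun x hx => h2 x (hsub (mk_mem_prod hx hq2)).2.1 _ (hsub (mk_mem_prod hx hq2)).2.2)
        (fun x hx => (hsub (mk_mem_prod hx hq2)).1) (x := ξ) (y := S)
        (hmem ξ (Ioo_subset_Icc_self hξ)) ⟨by linarith, by linarith⟩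
      refine hb.trans ?_
      have h3 : |S - ξ| ≤ ε / (M + 1) := by
        rw [abs_le]
        constructor <;> linarith [hξ.1, hξ.2, min_le_right ρ (ε / (M + 1))]
      calc M * |S - ξ| ≤ (M + 1) * (ε / (M + 1)) := by gcongr; linarith
        _ = ε := by field_simp
    exact h3.comp (f := fun t => ((0 : ℝ), t)) (by fun_prop) fun t ht => ⟨mem_univ _, ht⟩
  exact ⟨hf', key h1 hf (bdd hf')⟩

end

section

/-- The pointwise inequality behind the energy estimate. -/
lemma exists_energy_absorption {lam a1 a2 a3 a4 a5 a6 N : ℝ} (hlam : 0 < lam) (hN : 0 < N) :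
    ∃ B C : ℝ, ∀ M x w : ℝ, x ^ 2 ≤ N * w →
      lam / 4 * M ^ 2 ≤ (lam * M ^ 2 - a1 * (M * x) - a2 * M - a3 * w - a4 * x) +
        B * (w - a5 * x - a6 * M) + C ∧ 0 ≤ B := by
  set B := |a3| + N * (a1 ^ 2 / lam + 1) with hB
  have hB0 : 0 ≤ B := by positivity
  refine ⟨B, (a2 + B * a6) ^ 2 / lam + (a4 + B * a5) ^ 2, fun M x w hx => ⟨?_, hB0⟩⟩
  have hw : 0 ≤ w := by
    by_contra! h
    nlinarith [sq_nonneg x, mul_pos hN (neg_pos.2 h)]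
  have h1 : (a1 ^ 2 / lam + 1) * x ^ 2 ≤ (B - a3) * w := by
    have : (a1 ^ 2 / lam + 1) * x ^ 2 ≤ (a1 ^ 2 / lam + 1) * (N * w) := by gcongr
    nlinarith [mul_nonneg (sub_nonneg.2 (le_abs_self a3)) hw]
  have h2 : a1 * (M * x) ≤ lam / 4 * M ^ 2 + a1 ^ 2 / lam * x ^ 2 := by
    have : lam / 4 * M ^ 2 + a1 ^ 2 / lam * x ^ 2 - a1 * (M * x) =
        (lam * M / 2 - a1 * x) ^ 2 / lam := by field_simp; ring
    have h0 : 0 ≤ (lam * M / 2 - a1 * x) ^ 2 / lam := by positivity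
    linarith
  have h3 : (a2 + B * a6) * M ≤ lam / 4 * M ^ 2 + (a2 + B * a6) ^ 2 / lam := by
    have : lam / 4 * M ^ 2 + (a2 + B * a6) ^ 2 / lam - (a2 + B * a6) * M =
        (lam * M / 2 - (a2 + B * a6)) ^ 2 / lam := by field_simp; ring
    have h0 : 0 ≤ (lam * M / 2 - (a2 + B * a6)) ^ 2 / lam := by positivity
    linarith
  have h4 : (a4 + B * a5) * x ≤ x ^ 2 + (a4 + B * a5) ^ 2 := by
    nlinarith [sq_nonneg (x - (a4 + B * a5)), sq_nonneg x, sq_nonneg (a4 + B * a5)]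
  nlinarith [mul_nonneg hlam.le (sq_nonneg M)]

/-- The integrands of the two energy identities control the weighted square of `m`. -/
lemma exists_energy_pointwise {lam K N : ℝ} (hlam : 0 < lam) (hN : 0 < N) (hK : 0 ≤ K) :
    ∃ B C : ℝ, ∀ σ q p m e ζ ζ' η η' : ℝ, |σ| ≤ 1 → 0 ≤ ζ → ζ ≤ N → 0 ≤ η → η ≤ N → |ζ'| ≤ N →
      |η'| ≤ N → lam * m ^ 2 - K * (|p| + |q|) * |m| ≤ σ * (e * m) →
      |e| ≤ K * (|m| + |p| + |q|) → |q| ≤ K →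
      lam / 4 * (ζ * η ^ 2 * m) ^ 2 ≤
        σ * (ζ ^ 2 * (η ^ 4 * (e * m) + 4 * η ^ 3 * η' * (e * p)) - ζ * ζ' * (η ^ 4 * p ^ 2)) +
        B * (ζ * (η ^ 2 * p ^ 2 + 2 * η * η' * (q * p) + η ^ 2 * (q * m))) + C := by
  obtain ⟨B, C, hBC⟩ := exists_energy_absorption (lam := lam) (a1 := K * N + 4 * N * K)
    (a2 := K * (N ^ 3 * K)) (a3 := N ^ 3 + 4 * N * K * N ^ 2) (a4 := 4 * N * K * (N ^ 3 * K))
    (a5 := 2 * N * K) (a6 := K) hlam hN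
  refine ⟨B, C, fun σ q p m e ζ ζ' η η' hσ hζ0 hζ hη0 hη hζ' hη' hm he hq => ?_⟩
  set M := ζ * η ^ 2 * |m| with hM
  set x := ζ * η * |p| with hx
  set w := ζ * η ^ 2 * p ^ 2 with hw
  have hM0 : 0 ≤ M := by positivity
  have hx0 : 0 ≤ x := by positivity
  have hw0 : 0 ≤ w := by positivity
  have hxx : x ^ 2 ≤ N * w := by
    have : x ^ 2 = ζ * w := by rw [hx, hw, mul_pow, sq_abs]; ring
    rw [this]; gcongr
  obtain ⟨hmain, hB⟩ := hBC M x w hxx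
  have hMsq : (ζ * η ^ 2 * m) ^ 2 = M ^ 2 := by rw [hM, mul_pow, mul_pow _ |m|, sq_abs]
  have hζη : ζ * η ^ 2 ≤ N ^ 3 := by
    calc ζ * η ^ 2 ≤ N * N ^ 2 := by gcongr
      _ = N ^ 3 := by ring
  have t1 : lam * M ^ 2 - K * M * (N * x + N ^ 3 * K) ≤ σ * (ζ ^ 2 * (η ^ 4 * (e * m))) := by
    have h1 : (ζ * η ^ 2) ^ 2 * (lam * m ^ 2 - K * (|p| + |q|) * |m|) ≤
        (ζ * η ^ 2) ^ 2 * (σ * (e * m)) := by gcongr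
    have h2 : ζ * η ^ 2 * |p| ≤ N * x := by
      calc ζ * η ^ 2 * |p| = η * x := by rw [hx]; ring
        _ ≤ N * x := by gcongr
    have h3 : ζ * η ^ 2 * |q| ≤ N ^ 3 * K := by gcongr
    have h4 : K * M * (ζ * η ^ 2 * |p| + ζ * η ^ 2 * |q|) ≤ K * M * (N * x + N ^ 3 * K) := by
      gcongr
    have h5 : (ζ * η ^ 2) ^ 2 * (lam * m ^ 2 - K * (|p| + |q|) * |m|) =
        lam * M ^ 2 - K * M * (ζ * η ^ 2 * |p| + ζ * η ^ 2 * |q|) := by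
      rw [← hMsq, hM]; ring
    have h6 : (ζ * η ^ 2) ^ 2 * (σ * (e * m)) = σ * (ζ ^ 2 * (η ^ 4 * (e * m))) := by ring
    linarith
  have t2 : |ζ * ζ' * (η ^ 4 * p ^ 2)| ≤ N ^ 3 * w := by
    have : |ζ * ζ' * (η ^ 4 * p ^ 2)| = |ζ'| * η ^ 2 * w := by
      rw [abs_mul, abs_mul, abs_of_nonneg hζ0, abs_of_nonneg (by positivity : 0 ≤ η ^ 4 * p ^ 2),
        hw]; ring
    rw [this]
    calc |ζ'| * η ^ 2 * w ≤ N * N ^ 2 * w := by gcongr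
      _ = N ^ 3 * w := by ring
  have t3 : |ζ ^ 2 * (4 * η ^ 3 * η' * (e * p))| ≤
      4 * N * K * (M * x + N ^ 2 * w + N ^ 3 * K * x) := by
    have h0 : |ζ ^ 2 * (4 * η ^ 3 * η' * (e * p))| = 4 * |η'| * (ζ * η ^ 2) * |e| * x := by
      rw [hx]
      simp only [abs_mul, abs_pow, abs_of_nonneg hζ0, abs_of_nonneg hη0]
      norm_num; ring
    have h1 : ζ * η ^ 2 * |p| * x ≤ N ^ 2 * w := by
      have : ζ * η ^ 2 * |p| * x = ζ * η * w := by
        rw [hx, hw, ← sq_abs p]; ring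
      rw [this]
      calc ζ * η * w ≤ N * N * w := by gcongr
        _ = N ^ 2 * w := by ring
    have h2 : ζ * η ^ 2 * |q| * x ≤ N ^ 3 * K * x := by gcongr
    rw [h0]
    calc 4 * |η'| * (ζ * η ^ 2) * |e| * x
        ≤ 4 * N * (ζ * η ^ 2) * (K * (|m| + |p| + |q|)) * x := by gcongr
      _ = 4 * N * K * (M * x + ζ * η ^ 2 * |p| * x + ζ * η ^ 2 * |q| * x) := by rw [hM]; ring
      _ ≤ _ := by gcongr
  have t4 : w - 2 * N * K * x - K * M ≤
      ζ * (η ^ 2 * p ^ 2 + 2 * η * η' * (q * p) + η ^ 2 * (q * m)) := by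
    have h1 : |ζ * (2 * η * η' * (q * p))| ≤ 2 * N * K * x := by
      have : |ζ * (2 * η * η' * (q * p))| = 2 * |η'| * |q| * x := by
        rw [hx]
        simp only [abs_mul, abs_of_nonneg hζ0, abs_of_nonneg hη0]
        norm_num; ring
      rw [this]; gcongr
    have h2 : |ζ * (η ^ 2 * (q * m))| ≤ K * M := by
      have : |ζ * (η ^ 2 * (q * m))| = |q| * M := by
        rw [hM]
        simp only [abs_mul, abs_pow, abs_of_nonneg hζ0, abs_of_nonneg hη0]
        ring
      rw [this]; gcongr
    have h3 := neg_abs_le (ζ * (2 * η * η' * (q * p)))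
    have h4 := neg_abs_le (ζ * (η ^ 2 * (q * m)))
    have h5 : ζ * (η ^ 2 * p ^ 2 + 2 * η * η' * (q * p) + η ^ 2 * (q * m)) =
        w + ζ * (2 * η * η' * (q * p)) + ζ * (η ^ 2 * (q * m)) := by rw [hw]; ring
    linarith
  have hs : ∀ y : ℝ, -|y| ≤ σ * y := fun y => by
    have h1 : |σ * y| ≤ |y| := by
      rw [abs_mul]; exact mul_le_of_le_one_left (abs_nonneg _) hσ
    linarith [neg_abs_le (σ * y)]
  have s2 := hs (-(ζ * ζ' * (η ^ 4 * p ^ 2)))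
  rw [abs_neg] at s2
  have s3 := hs (ζ ^ 2 * (4 * η ^ 3 * η' * (e * p)))
  have t4' := mul_le_mul_of_nonneg_left t4 hB
  rw [hMsq]
  linear_combination hmain + t1 + t2 + t3 + t4' + s2 + s3

lemma continuousOn_parametric_integral {a b c d : ℝ} (hab : a ≤ b) (hcd : c ≤ d)
    {F : ℝ → ℝ → ℝ} (hF : ContinuousOn (uncurry F) (Icc c d ×ˢ Icc a b)) :
    ContinuousOn (fun t => ∫ S in c..d, F S t) (Icc a b) := by
  obtain ⟨G, hG, hGF⟩ := exists_continuous_extension hcd hab hF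
  have h1 : Continuous fun t => ∫ S in c..d, G S t :=
    intervalIntegral.continuous_parametric_intervalIntegral_of_continuous'
      (f := fun t S => G S t) (hG.comp continuous_swap) _ _
  refine h1.continuousOn.congr fun t ht => ?_
  refine intervalIntegral.integral_congr fun S hS => ?_
  rw [uIcc_of_le hcd] at hS
  exact (hGF S hS t ht).symm

lemma ContinuousOn.section_left {a b c d : ℝ} {F : ℝ → ℝ → ℝ}
    (hF : ContinuousOn (uncurry F) (Icc c d ×ˢ Icc a b)) {t : ℝ} (ht : t ∈ Icc a b) :
    ContinuousOn (fun S => F S t) (Icc c d) :=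
  hF.comp (f := fun S => (S, t)) (by fun_prop) fun _ hS => ⟨hS, ht⟩

lemma ContinuousOn.section_right {a b c d : ℝ} {F : ℝ → ℝ → ℝ}
    (hF : ContinuousOn (uncurry F) (Icc c d ×ˢ Icc a b)) {S : ℝ} (hS : S ∈ Icc c d) :
    ContinuousOn (fun t => F S t) (Icc a b) :=
  hF.comp (f := fun t => (S, t)) (by fun_prop) fun _ ht => ⟨hS, ht⟩

lemma exists_abs_bound {a b c d : ℝ} {F : ℝ → ℝ → ℝ}
    (hF : ContinuousOn (uncurry F) (Icc c d ×ˢ Icc a b)) :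
    ∃ C, ∀ S ∈ Icc c d, ∀ t ∈ Icc a b, |F S t| ≤ C := by
  obtain ⟨C, hC⟩ := (isCompact_Icc.prod isCompact_Icc).exists_bound_of_continuousOn hF
  exact ⟨C, fun S hS t ht => hC (S, t) ⟨hS, ht⟩⟩

lemma tendsto_integral_slope {a b c d : ℝ} (hcd : c ≤ d) {q e k : ℝ → ℝ → ℝ} {φ : ℝ → ℝ}
    (hφ : Continuous φ)
    (hq : ContinuousOn (uncurry q) (Icc c d ×ˢ Icc a b))
    (he : ContinuousOn (uncurry e) (Icc c d ×ˢ Icc a b))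
    (hk : ContinuousOn (uncurry k) (Icc c d ×ˢ Icc a b))
    (hqt : ∀ S ∈ Icc c d, ∀ t ∈ Icc a b, HasDerivAt (q S) (e S t) t)
    {t : ℝ} (ht : t ∈ Ioo a b) :
    Tendsto (fun s => ∫ S in c..d, φ S * slope (q S) t s * (k S s + k S t)) (𝓝[≠] t)
      (𝓝 (∫ S in c..d, φ S * e S t * (k S t + k S t))) := by
  have ht' := Ioo_subset_Icc_self ht
  obtain ⟨Ce, hCe⟩ := exists_abs_bound he
  obtain ⟨Ck, hCk⟩ := exists_abs_bound hk
  have hev : ∀ᶠ s in 𝓝[≠] t, s ∈ Ioo a b ∧ s ≠ t := by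
    filter_upwards [nhdsWithin_le_nhds (isOpen_Ioo.mem_nhds ht), self_mem_nhdsWithin]
      with s h1 h2 using ⟨h1, h2⟩
  refine intervalIntegral.tendsto_integral_filter_of_dominated_convergence
    (fun S => |φ S| * Ce * (Ck + Ck)) ?_ ?_ ?_ ?_
  · filter_upwards [hev] with s hs
    have hs' := Ioo_subset_Icc_self hs.1
    rw [uIoc_of_le hcd]
    refine (ContinuousOn.mono ?_ Ioc_subset_Icc_self).aestronglyMeasurable measurableSet_Ioc
    simp only [slope_def_field]
    exact (hφ.continuousOn.mul (((ContinuousOn.section_left hq hs').sub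
      (ContinuousOn.section_left hq ht')).div_const _)).mul
      ((ContinuousOn.section_left hk hs').add (ContinuousOn.section_left hk ht'))
  · filter_upwards [hev] with s hs
    refine ae_of_all _ fun S hS => ?_
    rw [uIoc_of_le hcd] at hS
    have hS' := Ioc_subset_Icc_self hS
    have hs' := Ioo_subset_Icc_self hs.1
    have h1 : |slope (q S) t s| ≤ Ce := by
      rw [slope_def_field, abs_div, div_le_iff₀ (abs_pos.2 (sub_ne_zero.2 hs.2))]
      exact abs_sub_le_of_deriv_bound (convex_Icc a b) (fun x hx => hqt S hS' x hx)
        (fun x hx => hCe S hS' x hx) ht' hs'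
    have h2 : |k S s + k S t| ≤ Ck + Ck :=
      (abs_add_le _ _).trans (add_le_add (hCk S hS' s hs') (hCk S hS' t ht'))
    rw [Real.norm_eq_abs, abs_mul, abs_mul]
    have : 0 ≤ Ce := (abs_nonneg _).trans h1
    gcongr
  · exact (by fun_prop : Continuous fun S => |φ S| * Ce * (Ck + Ck)).intervalIntegrable _ _
  · refine ae_of_all _ fun S hS => ?_
    rw [uIoc_of_le hcd] at hS
    have hS' := Ioc_subset_Icc_self hS
    have h1 := hasDerivAt_iff_tendsto_slope.1 (hqt S hS' t ht')
    have h2 : Tendsto (k S) (𝓝[≠] t) (𝓝 (k S t)) :=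
      (((ContinuousOn.section_right hk hS').continuousAt
        (Icc_mem_nhds ht.1 ht.2)).tendsto).mono_left nhdsWithin_le_nhds
    exact (h1.const_mul _).mul (h2.add_const _)

/-- Time derivative of the weighted energy `∫ φ p²`. -/
lemma hasDerivAt_energy {a b c d : ℝ} (hcd : c ≤ d) {q p m e : ℝ → ℝ → ℝ} {φ φ' : ℝ → ℝ}
    (hφ : ∀ S, HasDerivAt φ (φ' S) S) (hφ' : Continuous φ') (hφc : φ c = 0) (hφd : φ d = 0)
    (hq : ContinuousOn (uncurry q) (Icc c d ×ˢ Icc a b))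
    (hp : ContinuousOn (uncurry p) (Icc c d ×ˢ Icc a b))
    (hm : ContinuousOn (uncurry m) (Icc c d ×ˢ Icc a b))
    (he : ContinuousOn (uncurry e) (Icc c d ×ˢ Icc a b))
    (hqS : ∀ S ∈ Icc c d, ∀ t ∈ Icc a b, HasDerivAt (fun S => q S t) (p S t) S)
    (hpS : ∀ S ∈ Icc c d, ∀ t ∈ Icc a b, HasDerivAt (fun S => p S t) (m S t) S)
    (hqt : ∀ S ∈ Icc c d, ∀ t ∈ Icc a b, HasDerivAt (q S) (e S t) t)
    {t : ℝ} (ht : t ∈ Ioo a b) :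
    HasDerivAt (fun t => ∫ S in c..d, φ S * p S t ^ 2)
      (-2 * ∫ S in c..d, (φ S * (e S t * m S t) + φ' S * (e S t * p S t))) t := by
  have hφ0 : Continuous φ := continuous_iff_continuousAt.2 fun S => (hφ S).continuousAt
  have ht' := Ioo_subset_Icc_self ht
  have ii : ∀ {f : ℝ → ℝ}, ContinuousOn f (Icc c d) → IntervalIntegrable f volume c d :=
    fun hf => (hf.mono (uIcc_of_le hcd).subset).intervalIntegrable
  rw [hasDerivAt_iff_tendsto_slope]
  have h1 := tendsto_integral_slope hcd hφ0 hq he hm hqt ht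
  have h2 := tendsto_integral_slope hcd hφ' hq he hp hqt ht
  have hp1 := fun {s} (hs : s ∈ Icc a b) => ContinuousOn.section_left hp hs
  have hq1 := fun {s} (hs : s ∈ Icc a b) => ContinuousOn.section_left hq hs
  have hm1 := fun {s} (hs : s ∈ Icc a b) => ContinuousOn.section_left hm hs
  have he1 := fun {s} (hs : s ∈ Icc a b) => ContinuousOn.section_left he hs
  have hlim : -2 * ∫ S in c..d, (φ S * (e S t * m S t) + φ' S * (e S t * p S t)) =
      -((∫ S in c..d, φ S * e S t * (m S t + m S t)) +
        ∫ S in c..d, φ' S * e S t * (p S t + p S t)) := by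
    have j1 : IntervalIntegrable (fun S => φ S * e S t * (m S t + m S t)) volume c d :=
      ii ((hφ0.continuousOn.mul (he1 ht')).mul ((hm1 ht').add (hm1 ht')))
    have j2 : IntervalIntegrable (fun S => φ' S * e S t * (p S t + p S t)) volume c d :=
      ii ((hφ'.continuousOn.mul (he1 ht')).mul ((hp1 ht').add (hp1 ht')))
    rw [← intervalIntegral.integral_add j1 j2, ← intervalIntegral.integral_const_mul,
      ← intervalIntegral.integral_neg]
    congr 1; funext S; ring
  rw [hlim]
  refine (h1.add h2).neg.congr' ?_
  filter_upwards [nhdsWithin_le_nhds (isOpen_Ioo.mem_nhds ht), self_mem_nhdsWithin] with s hs hst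
  have hs' := Ioo_subset_Icc_self hs
  have hst' : s - t ≠ 0 := sub_ne_zero.2 hst
  have hFTC : ∫ S in c..d, (φ' S * ((q S s - q S t) * (p S s + p S t)) +
      φ S * ((p S s - p S t) * (p S s + p S t) + (q S s - q S t) * (m S s + m S t))) = 0 := by
    have hder : ∀ S ∈ uIcc c d, HasDerivAt
        (fun S => φ S * ((q S s - q S t) * (p S s + p S t)))
        (φ' S * ((q S s - q S t) * (p S s + p S t)) + φ S * ((p S s - p S t) * (p S s + p S t) +
          (q S s - q S t) * (m S s + m S t))) S := fun S hS => by
      rw [uIcc_of_le hcd] at hS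
      exact (hφ S).mul (((hqS S hS s hs').sub (hqS S hS t ht')).mul
        ((hpS S hS s hs').add (hpS S hS t ht')))
    rw [intervalIntegral.integral_eq_sub_of_hasDerivAt hder (ii ?_)]
    · simp [hφc, hφd]
    · exact (hφ'.continuousOn.mul (((hq1 hs').sub (hq1 ht')).mul ((hp1 hs').add (hp1 ht')))).add
        (hφ0.continuousOn.mul ((((hp1 hs').sub (hp1 ht')).mul ((hp1 hs').add (hp1 ht'))).add
        (((hq1 hs').sub (hq1 ht')).mul ((hm1 hs').add (hm1 ht')))))
  simp only [slope_def_field]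
  have i1 : IntervalIntegrable (fun S => φ S * p S s ^ 2) volume c d :=
    ii (hφ0.continuousOn.mul ((hp1 hs').pow 2))
  have i2 : IntervalIntegrable (fun S => φ S * p S t ^ 2) volume c d :=
    ii (hφ0.continuousOn.mul ((hp1 ht').pow 2))
  have i3 : IntervalIntegrable (fun S => φ S * ((q S s - q S t) / (s - t)) * (m S s + m S t))
      volume c d := ii ((hφ0.continuousOn.mul (((hq1 hs').sub (hq1 ht')).div_const (s - t))).mul
    ((hm1 hs').add (hm1 ht')))
  have i4 : IntervalIntegrable (fun S => φ' S * ((q S s - q S t) / (s - t)) * (p S s + p S t))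
      volume c d := ii ((hφ'.continuousOn.mul (((hq1 hs').sub (hq1 ht')).div_const (s - t))).mul
    ((hp1 hs').add (hp1 ht')))
  rw [← intervalIntegral.integral_add i3 i4, ← intervalIntegral.integral_sub i1 i2,
    eq_div_iff hst', neg_mul, ← intervalIntegral.integral_mul_const, ← sub_eq_zero,
    ← intervalIntegral.integral_neg, ← intervalIntegral.integral_sub]
  · rw [← neg_eq_zero, ← intervalIntegral.integral_neg, ← hFTC]
    congr 1; funext S; field_simp; ring
  · exact ((i3.add i4).mul_const _).neg
  · exact i1.sub i2

end

section

lemma bump_bounds {a b N t : ℝ} (hN : 1 + (b - a) ^ 2 ≤ N) (ht : t ∈ Icc a b) :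
    0 ≤ (t - a) * (b - t) ∧ (t - a) * (b - t) ≤ N ∧ |a + b - 2 * t| ≤ N := by
  obtain ⟨h1, h2⟩ := ht
  refine ⟨mul_nonneg (by linarith) (by linarith), by nlinarith, abs_le.2 ⟨?_, ?_⟩⟩ <;>
    nlinarith [sq_nonneg (b - a - 1)]

lemma hasDerivAt_bump (a b t : ℝ) :
    HasDerivAt (fun t => (t - a) * (b - t)) (a + b - 2 * t) t := by
  refine (((hasDerivAt_id t).sub_const a).mul ((hasDerivAt_id t).const_sub b)).congr_deriv ?_
  simp only [id]; ring

/-- Interior energy estimate for `p = ∂_S q`, `m = ∂²_S q`, `e = ∂ₜq` when `e` is comparable to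
`m` up to lower order terms. -/
lemma exists_energy_estimate {a b c d lam K : ℝ} (hab : a < b) (hcd : c < d) (hlam : 0 < lam)
    (hK : 0 ≤ K) : ∃ C : ℝ, ∀ (σ : ℝ) (q p m e : ℝ → ℝ → ℝ), |σ| ≤ 1 →
      ContinuousOn (uncurry q) (Icc c d ×ˢ Icc a b) →
      ContinuousOn (uncurry p) (Icc c d ×ˢ Icc a b) →
      ContinuousOn (uncurry m) (Icc c d ×ˢ Icc a b) →
      ContinuousOn (uncurry e) (Icc c d ×ˢ Icc a b) →
      (∀ S ∈ Icc c d, ∀ t ∈ Icc a b, HasDerivAt (fun S => q S t) (p S t) S) →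
      (∀ S ∈ Icc c d, ∀ t ∈ Icc a b, HasDerivAt (fun S => p S t) (m S t) S) →
      (∀ S ∈ Icc c d, ∀ t ∈ Icc a b, HasDerivAt (q S) (e S t) t) →
      (∀ S ∈ Icc c d, ∀ t ∈ Icc a b,
        lam * m S t ^ 2 - K * (|p S t| + |q S t|) * |m S t| ≤ σ * (e S t * m S t)) →
      (∀ S ∈ Icc c d, ∀ t ∈ Icc a b, |e S t| ≤ K * (|m S t| + |p S t| + |q S t|)) →
      (∀ S ∈ Icc c d, ∀ t ∈ Icc a b, |q S t| ≤ K) →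
      ∫ t in a..b, ∫ S in c..d,
        (((t - a) * (b - t)) * ((S - c) * (d - S)) ^ 2 * m S t) ^ 2 ≤ C := by
  set N := 1 + (b - a) ^ 2 + (d - c) ^ 2 with hNdef
  have hN1 : 1 + (b - a) ^ 2 ≤ N := by nlinarith [sq_nonneg (d - c)]
  have hN2 : 1 + (d - c) ^ 2 ≤ N := by nlinarith [sq_nonneg (b - a)]
  have hN : 0 < N := by positivity
  obtain ⟨B, C, hBC⟩ := exists_energy_pointwise hlam hN hK
  refine ⟨4 / lam * ((b - a) * (C * (d - c))), ?_⟩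
  intro σ q p m e hσ hq hp hm he hqS hpS hqt hell hbd hqK
  have hq1 := fun {s} (hs : s ∈ Icc a b) => ContinuousOn.section_left hq hs
  have hp1 := fun {s} (hs : s ∈ Icc a b) => ContinuousOn.section_left hp hs
  have hm1 := fun {s} (hs : s ∈ Icc a b) => ContinuousOn.section_left hm hs
  have he1 := fun {s} (hs : s ∈ Icc a b) => ContinuousOn.section_left he hs
  have ii : ∀ {f : ℝ → ℝ}, ContinuousOn f (Icc c d) → IntervalIntegrable f volume c d :=
    fun hf => (hf.mono (uIcc_of_le hcd.le).subset).intervalIntegrable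
  set η : ℝ → ℝ := fun S => (S - c) * (d - S) with hη
  set η' : ℝ → ℝ := fun S => c + d - 2 * S with hη'
  set ζ : ℝ → ℝ := fun t => (t - a) * (b - t) with hζ
  set ζ' : ℝ → ℝ := fun t => a + b - 2 * t with hζ'
  have hηc : Continuous η := by fun_prop
  have hηc' : Continuous η' := by fun_prop
  have hζc : Continuous ζ := by fun_prop
  have hζc' : Continuous ζ' := by fun_prop
  set A : ℝ → ℝ := fun t =>
    ∫ S in c..d, (η S ^ 4 * (e S t * m S t) + 4 * η S ^ 3 * η' S * (e S t * p S t)) with hA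
  set F : ℝ → ℝ := fun t => ∫ S in c..d, η S ^ 4 * p S t ^ 2 with hF
  have hηu : ContinuousOn (fun x : ℝ × ℝ => η x.1) (Icc c d ×ˢ Icc a b) := by fun_prop
  have hηu' : ContinuousOn (fun x : ℝ × ℝ => η' x.1) (Icc c d ×ˢ Icc a b) := by fun_prop
  have hAc : ContinuousOn A (Icc a b) := by
    refine continuousOn_parametric_integral hab.le hcd.le (F := fun S t =>
      η S ^ 4 * (e S t * m S t) + 4 * η S ^ 3 * η' S * (e S t * p S t)) ?_
    exact ((hηu.pow 4).mul (he.mul hm)).add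
      (((continuousOn_const.mul (hηu.pow 3)).mul hηu').mul (he.mul hp))
  have hFc : ContinuousOn F (Icc a b) :=
    continuousOn_parametric_integral hab.le hcd.le (F := fun S t => η S ^ 4 * p S t ^ 2)
      ((hηu.pow 4).mul (hp.pow 2))
  have hI1 : ∫ t in a..b, (ζ t ^ 2 * A t - ζ t * ζ' t * F t) = 0 := by
    have hd : ∀ t ∈ Ioo a b, HasDerivAt (fun t => -(1 / 2) * (ζ t ^ 2 * F t))
        (ζ t ^ 2 * A t - ζ t * ζ' t * F t) t := by
      intro t ht
      have h1 := hasDerivAt_energy (a := a) (b := b) hcd.le (φ := fun S => η S ^ 4)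
        (φ' := fun S => 4 * η S ^ 3 * η' S)
        (fun S => ((hasDerivAt_bump c d S).pow 4).congr_deriv (by simp [hη, hη'])) (by fun_prop)
        (by simp [hη]) (by simp [hη]) hq hp hm he hqS hpS hqt ht
      refine ((((hasDerivAt_bump a b t).pow 2).mul h1).const_mul (-(1 / 2))).congr_deriv ?_
      simp only [hA, hF, hζ, hζ', Pi.pow_apply]
      push_cast
      ring
    have hcont : ContinuousOn (fun t => ζ t ^ 2 * A t - ζ t * ζ' t * F t) (Icc a b) :=
      ((hζc.continuousOn.pow 2).mul hAc).sub
        ((hζc.continuousOn.mul hζc'.continuousOn).mul hFc)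
    rw [intervalIntegral.integral_eq_sub_of_hasDerivAt_of_le hab.le
      (continuousOn_const.mul ((hζc.continuousOn.pow 2).mul hFc)) hd
      ((hcont.mono (uIcc_of_le hab.le).subset).intervalIntegrable)]
    simp [hζ]
  have hI2 : ∀ t ∈ Icc a b, ∫ S in c..d, (η S ^ 2 * p S t ^ 2 +
      2 * η S * η' S * (q S t * p S t) + η S ^ 2 * (q S t * m S t)) = 0 := by
    intro t ht
    have hder : ∀ S ∈ uIcc c d, HasDerivAt (fun S => η S ^ 2 * (q S t * p S t))
        (η S ^ 2 * p S t ^ 2 + 2 * η S * η' S * (q S t * p S t) +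
          η S ^ 2 * (q S t * m S t)) S := by
      intro S hS
      rw [uIcc_of_le hcd.le] at hS
      refine (((hasDerivAt_bump c d S).pow 2).mul
        ((hqS S hS t ht).mul (hpS S hS t ht))).congr_deriv ?_
      simp only [hη, hη', Pi.pow_apply, Pi.mul_apply]
      push_cast
      ring
    rw [intervalIntegral.integral_eq_sub_of_hasDerivAt hder (ii ?_)]
    · simp [hη]
    · exact (((hηc.continuousOn.pow 2).mul ((hp1 ht).pow 2)).add
        (((continuousOn_const.mul hηc.continuousOn).mul hηc'.continuousOn).mul
          ((hq1 ht).mul (hp1 ht)))).add ((hηc.continuousOn.pow 2).mul ((hq1 ht).mul (hm1 ht)))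
  have hinner : ∀ t ∈ Icc a b, ∫ S in c..d, (ζ t * η S ^ 2 * m S t) ^ 2 ≤
      4 / lam * (σ * (ζ t ^ 2 * A t - ζ t * ζ' t * F t) + C * (d - c)) := by
    intro t ht
    have j1 : IntervalIntegrable (fun S => η S ^ 4 * (e S t * m S t) +
        4 * η S ^ 3 * η' S * (e S t * p S t)) volume c d :=
      ii (((hηc.continuousOn.pow 4).mul ((he1 ht).mul (hm1 ht))).add
        (((continuousOn_const.mul (hηc.continuousOn.pow 3)).mul hηc'.continuousOn).mul
          ((he1 ht).mul (hp1 ht))))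
    have j2 : IntervalIntegrable (fun S => η S ^ 4 * p S t ^ 2) volume c d :=
      ii ((hηc.continuousOn.pow 4).mul ((hp1 ht).pow 2))
    have j3 : IntervalIntegrable (fun S => η S ^ 2 * p S t ^ 2 +
        2 * η S * η' S * (q S t * p S t) + η S ^ 2 * (q S t * m S t)) volume c d :=
      ii ((((hηc.continuousOn.pow 2).mul ((hp1 ht).pow 2)).add
        (((continuousOn_const.mul hηc.continuousOn).mul hηc'.continuousOn).mul
          ((hq1 ht).mul (hp1 ht)))).add ((hηc.continuousOn.pow 2).mul ((hq1 ht).mul (hm1 ht))))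
    have j4 : IntervalIntegrable (fun _ : ℝ => C) volume c d := by simp
    have hmono : ∫ S in c..d, (ζ t * η S ^ 2 * m S t) ^ 2 ≤
        ∫ S in c..d, (4 / lam * (σ * (ζ t ^ 2 * (η S ^ 4 * (e S t * m S t) +
          4 * η S ^ 3 * η' S * (e S t * p S t)) - ζ t * ζ' t * (η S ^ 4 * p S t ^ 2)) +
        B * (ζ t * (η S ^ 2 * p S t ^ 2 + 2 * η S * η' S * (q S t * p S t) +
          η S ^ 2 * (q S t * m S t))) + C)) := by
      refine intervalIntegral.integral_mono_on hcd.le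
        (ii (((continuousOn_const.mul (hηc.continuousOn.pow 2)).mul (hm1 ht)).pow 2))
        ((((((j1.const_mul _).sub (j2.const_mul _)).const_mul _).add
          ((j3.const_mul _).const_mul _)).add j4).const_mul _) fun S hS => ?_
      obtain ⟨z1, z2, z3⟩ := bump_bounds hN1 ht
      obtain ⟨y1, y2, y3⟩ := bump_bounds hN2 hS
      have := hBC σ (q S t) (p S t) (m S t) (e S t) (ζ t) (ζ' t) (η S) (η' S) hσ z1 z2 y1 y2 z3 y3
        (hell S hS t ht) (hbd S hS t ht) (hqK S hS t ht)
      rw [div_mul_eq_mul_div, le_div_iff₀ hlam]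
      linarith
    refine hmono.trans_eq ?_
    rw [intervalIntegral.integral_const_mul, intervalIntegral.integral_add
      ((((j1.const_mul _).sub (j2.const_mul _)).const_mul _).add
          ((j3.const_mul _).const_mul _)) j4, intervalIntegral.integral_add
      (((j1.const_mul _).sub (j2.const_mul _)).const_mul _) ((j3.const_mul _).const_mul _),
      intervalIntegral.integral_const_mul, intervalIntegral.integral_sub
      (j1.const_mul _) (j2.const_mul _)]
    simp only [intervalIntegral.integral_const_mul, hI2 t ht, intervalIntegral.integral_const,
      smul_eq_mul]
    simp only [hA, hF, mul_zero, add_zero]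
    ring
  have hcontL : ContinuousOn (fun t => ∫ S in c..d, (ζ t * η S ^ 2 * m S t) ^ 2) (Icc a b) := by
    refine continuousOn_parametric_integral hab.le hcd.le
      (F := fun S t => (ζ t * η S ^ 2 * m S t) ^ 2) ?_
    have hζu : ContinuousOn (fun x : ℝ × ℝ => ζ x.2) (Icc c d ×ˢ Icc a b) := by fun_prop
    exact ((hζu.mul (hηu.pow 2)).mul hm).pow 2
  have k1 : IntervalIntegrable (fun t => ζ t ^ 2 * A t - ζ t * ζ' t * F t) volume a b := by
    refine ContinuousOn.intervalIntegrable ?_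
    rw [uIcc_of_le hab.le]
    exact ((hζc.continuousOn.pow 2).mul hAc).sub
        ((hζc.continuousOn.mul hζc'.continuousOn).mul hFc)
  have k2 : IntervalIntegrable (fun _ : ℝ => C * (d - c)) volume a b := by simp
  have hout := intervalIntegral.integral_mono_on hab.le
    ((hcontL.mono (uIcc_of_le hab.le).subset).intervalIntegrable)
    (((k1.const_mul σ).add k2).const_mul (4 / lam)) hinner
  refine hout.trans_eq ?_
  rw [intervalIntegral.integral_const_mul, intervalIntegral.integral_add (k1.const_mul σ) k2,
    intervalIntegral.integral_const_mul, hI1]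
  simp only [intervalIntegral.integral_const, smul_eq_mul]
  ring

end

section

variable {r : ℝ} {β : ℝ → ℝ} {V p h l W γ : ℝ → ℝ → ℝ} {J I : Set ℝ}

lemma exists_deriv_eq_of_convex {f f' : ℝ → ℝ} {s : Set ℝ} (hs : s.OrdConnected)
    (h : ∀ x ∈ s, HasDerivAt f (f' x) x) {x y : ℝ} (hx : x ∈ s) (hy : y ∈ s) :
    ∃ ξ ∈ s, f y - f x = f' ξ * (y - x) := by
  rcases lt_trichotomy x y with hxy | rfl | hxy
  · obtain ⟨ξ, hξ, he⟩ := exists_deriv_eq_sub hxy fun z hz => h z (hs.out hx hy hz)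
    exact ⟨ξ, hs.out hx hy (Ioo_subset_Icc_self hξ), he⟩
  · exact ⟨x, hx, by ring⟩
  · obtain ⟨ξ, hξ, he⟩ := exists_deriv_eq_sub hxy fun z hz => h z (hs.out hy hx hz)
    exact ⟨ξ, hs.out hy hx (Ioo_subset_Icc_self hξ), by linear_combination -he⟩

/-- The pointwise structure of the equation satisfied by difference quotients. -/
lemma quotient_pointwise {r S S₁ S₂ s b lam₀ Λ K q p m e : ℝ} (hs : |s| = 1) (hS₁ : 0 < S₁)
    (h1 : S₁ ≤ S) (h2 : S ≤ S₂) (hlam : 0 ≤ lam₀) (hb : lam₀ ≤ s * b) (hb' : |b| ≤ Λ)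
    (hK1 : |r| * (S₂ + 1) ≤ K) (hK2 : S₂ ^ 2 * Λ ≤ K)
    (he : e = -(S ^ 2 * (b * m)) - r * S * p + r * q) :
    S₁ ^ 2 * lam₀ * m ^ 2 - K * (|p| + |q|) * |m| ≤ -s * (e * m) ∧
      |e| ≤ K * (|m| + |p| + |q|) := by
  have hS : 0 < S := hS₁.trans_le h1
  have hS₂ : 0 < S₂ := hS.trans_le h2
  have k1 : |r * S * p| ≤ K * |p| := by
    rw [abs_mul, abs_mul, abs_of_pos hS]
    refine mul_le_mul_of_nonneg_right (le_trans ?_ hK1) (abs_nonneg p)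
    exact mul_le_mul_of_nonneg_left (by linarith) (abs_nonneg r)
  have k2 : |r * q| ≤ K * |q| := by
    rw [abs_mul]
    refine mul_le_mul_of_nonneg_right (le_trans ?_ hK1) (abs_nonneg q)
    nlinarith [abs_nonneg r]
  have k3 : |S ^ 2 * (b * m)| ≤ K * |m| := by
    rw [abs_mul, abs_mul, abs_of_pos (pow_pos hS 2), ← mul_assoc]
    refine mul_le_mul_of_nonneg_right (le_trans ?_ hK2) (abs_nonneg m)
    gcongr
  constructor
  · have e1 : -s * (e * m) =
        S ^ 2 * (s * b) * m ^ 2 + s * ((r * S * p) * m) - s * ((r * q) * m) := by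
      rw [he]; ring
    have e2 : S₁ ^ 2 * lam₀ * m ^ 2 ≤ S ^ 2 * (s * b) * m ^ 2 := by gcongr
    have e3 : |s * ((r * S * p) * m)| ≤ K * |p| * |m| := by
      rw [abs_mul, hs, one_mul, abs_mul]; gcongr
    have e4 : |s * ((r * q) * m)| ≤ K * |q| * |m| := by
      rw [abs_mul, hs, one_mul, abs_mul]; gcongr
    have e5 := neg_abs_le (s * ((r * S * p) * m))
    have e6 := le_abs_self (s * ((r * q) * m))
    rw [e1]
    linarith
  · rw [he]
    calc |-(S ^ 2 * (b * m)) - r * S * p + r * q|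
        ≤ |-(S ^ 2 * (b * m)) - r * S * p| + |r * q| := abs_add_le _ _
      _ ≤ |-(S ^ 2 * (b * m))| + |r * S * p| + |r * q| := by gcongr; exact abs_sub _ _
      _ ≤ K * |m| + K * |p| + K * |q| := by rw [abs_neg]; gcongr
      _ = K * (|m| + |p| + |q|) := by ring

lemma SeparateSolution.continuousOn_W {c d u v : ℝ}
    (hs : SeparateSolution r β V p h l W γ (Ioo c d) (Ioo u v)) (hβ : Continuous β)
    (hh : ContinuousOn (uncurry h) (Ioo c d ×ˢ Ioo u v)) :
    ContinuousOn (uncurry p) (Ioo c d ×ˢ Ioo u v) ∧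
      ContinuousOn (uncurry V) (Ioo c d ×ˢ Ioo u v) ∧
      ContinuousOn (uncurry W) (Ioo c d ×ˢ Ioo u v) := by
  obtain ⟨hp, hV⟩ := continuousOn_of_continuousOn_second isOpen_Ioo isOpen_Ioo hs.V_S hs.p_S
    (fun S hS t ht => (hs.V_t S hS t ht).continuousAt.continuousWithinAt) hh
  refine ⟨hp, hV, ?_⟩
  have hfst : ContinuousOn (fun q : ℝ × ℝ => q.1) (Ioo c d ×ˢ Ioo u v) := by fun_prop
  have : ContinuousOn (fun q : ℝ × ℝ => -(q.1 * β (q.1 * uncurry h q)) - r * q.1 * uncurry p q +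
      r * uncurry V q) (Ioo c d ×ˢ Ioo u v) :=
    (((hfst.mul (hβ.comp_continuousOn (hfst.mul hh))).neg).sub
      ((continuousOn_const.mul hfst).mul hp)).add (continuousOn_const.mul hV)
  exact this.congr fun q hq => hs.pde q.1 hq.1 q.2 hq.2

/-- Where the equation is nondegenerate, time difference quotients of `h` are locally bounded in
`L²`. -/
lemma SeparateSolution.exists_quotient_bound {c d u v : ℝ}
    (hs : SeparateSolution r β V p h l W γ (Ioo c d) (Ioo u v)) (hβ : ContDiff ℝ 2 β)
    (hh : ContinuousOn (uncurry h) (Ioo c d ×ˢ Ioo u v)) {S₀ t₀ : ℝ} (hS₀ : S₀ ∈ Ioo c d)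
    (ht₀ : t₀ ∈ Ioo u v) (ha : deriv β (S₀ * h S₀ t₀) ≠ 0) :
    ∃ ρ > 0, Icc (S₀ - ρ) (S₀ + ρ) ⊆ Ioo c d ∧ Icc (t₀ - 2 * ρ) (t₀ + 2 * ρ) ⊆ Ioo u v ∧
      ∃ C, ∀ δ ∈ Ioo 0 ρ, ∫ t in (t₀ - ρ)..(t₀ + ρ), ∫ S in (S₀ - ρ)..(S₀ + ρ),
        ((h S (t + δ) - h S t) / δ) ^ 2 ≤ C := by
  have hβ1 : ∀ x, HasDerivAt β (deriv β x) x :=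
    fun x => (hβ.differentiable (by norm_num) x).hasDerivAt
  have hβc : Continuous (deriv β) := hβ.continuous_deriv (by norm_num)
  obtain ⟨hpc, hVc, hWc⟩ := hs.continuousOn_W hβ.continuous hh
  set b₀ := deriv β (S₀ * h S₀ t₀) with hb₀
  have hb₀p : 0 < |b₀| := abs_pos.2 ha
  set s : ℝ := b₀ / |b₀| with hsdef
  have hs1 : |s| = 1 := by rw [hsdef, abs_div, abs_abs, div_self hb₀p.ne']
  have hsb : s * b₀ = |b₀| := by
    rw [hsdef, div_mul_eq_mul_div, div_eq_iff hb₀p.ne', ← sq, ← sq, sq_abs]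
  obtain ⟨ε, hε, hball⟩ : ∃ ε > 0, ∀ y ∈ Metric.ball (S₀ * h S₀ t₀) ε,
      |b₀| / 2 ≤ s * deriv β y ∧ |deriv β y| ≤ 2 * |b₀| := by
    have h1 : ∀ᶠ y in 𝓝 (S₀ * h S₀ t₀), |b₀| / 2 < s * deriv β y :=
      (continuous_const.mul hβc).continuousAt.eventually
        (lt_mem_nhds (show |b₀| / 2 < s * b₀ by rw [hsb]; linarith))
    have h2 : ∀ᶠ y in 𝓝 (S₀ * h S₀ t₀), |deriv β y| < 2 * |b₀| :=
      hβc.abs.continuousAt.eventually (gt_mem_nhds (show |b₀| < 2 * |b₀| by linarith))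
    obtain ⟨ε, hε, hb⟩ := Metric.eventually_nhds_iff_ball.1 (h1.and h2)
    exact ⟨ε, hε, fun y hy => ⟨(hb y hy).1.le, (hb y hy).2.le⟩⟩
  have hG : Ioo c d ×ˢ Ioo u v ∈ 𝓝 (S₀, t₀) :=
    (isOpen_Ioo.prod isOpen_Ioo).mem_nhds ⟨hS₀, ht₀⟩
  have hHc : ContinuousAt (fun q : ℝ × ℝ => q.1 * h q.1 q.2) (S₀, t₀) :=
    continuousAt_fst.mul (hh.continuousAt hG)
  obtain ⟨R, hR, hRs⟩ := exists_rect_subset (inter_mem hG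
    (hHc.eventually (Metric.ball_mem_nhds _ hε)))
  set ρ := R / 4 with hρ
  have hρ0 : 0 < ρ := by positivity
  have hRρ : R = 4 * ρ := by rw [hρ]; ring
  have hmem : ∀ S ∈ Icc (S₀ - 2 * ρ) (S₀ + 2 * ρ), ∀ t ∈ Icc (t₀ - 4 * ρ) (t₀ + 4 * ρ),
      S ∈ Ioo c d ∧ t ∈ Ioo u v ∧ S * h S t ∈ Metric.ball (S₀ * h S₀ t₀) ε := by
    intro S hS t ht
    have := @hRs (S, t) ⟨⟨by linarith [hS.1], by linarith [hS.2]⟩,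
      ⟨by linarith [ht.1], by linarith [ht.2]⟩⟩
    exact ⟨this.1.1, this.1.2, this.2⟩
  have hsubG : Icc (S₀ - 2 * ρ) (S₀ + 2 * ρ) ×ˢ Icc (t₀ - 4 * ρ) (t₀ + 4 * ρ) ⊆
      Ioo c d ×ˢ Ioo u v := fun q hq => ⟨(hmem _ hq.1 _ hq.2).1, (hmem _ hq.1 _ hq.2).2.1⟩
  have hleft : S₀ - 2 * ρ ∈ Icc (S₀ - 2 * ρ) (S₀ + 2 * ρ) := ⟨le_rfl, by linarith⟩
  have hmid : t₀ ∈ Icc (t₀ - 4 * ρ) (t₀ + 4 * ρ) := ⟨by linarith, by linarith⟩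
  have hS₁ : 0 < S₀ - 2 * ρ := hs.pos _ (hmem _ hleft _ hmid).1
  obtain ⟨K₀, hK₀⟩ := exists_abs_bound (hWc.mono hsubG)
  have hK₀0 : 0 ≤ K₀ := (abs_nonneg _).trans (hK₀ _ hleft _ hmid)
  set K := K₀ + |r| * (S₀ + 2 * ρ + 1) + (S₀ + 2 * ρ) ^ 2 * (2 * |b₀|) with hK
  have hS₂ : 0 < S₀ + 2 * ρ := by linarith
  have k1 : 0 ≤ |r| * (S₀ + 2 * ρ + 1) := by positivity
  have k2 : 0 ≤ (S₀ + 2 * ρ) ^ 2 * (2 * |b₀|) := by positivity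
  obtain ⟨C, hC⟩ := exists_energy_estimate (a := t₀ - 2 * ρ) (b := t₀ + 2 * ρ) (c := S₀ - 2 * ρ)
    (d := S₀ + 2 * ρ) (lam := (S₀ - 2 * ρ) ^ 2 * (|b₀| / 2)) (K := K) (by linarith) (by linarith)
    (by positivity) (by linarith)
  refine ⟨ρ, hρ0, fun S hS => (hmem S ⟨by linarith [hS.1], by linarith [hS.2]⟩ t₀ hmid).1,
    fun t ht => (hmem _ hleft t ⟨by linarith [ht.1], by linarith [ht.2]⟩).2.1,
    C / ρ ^ 12, fun δ hδ => ?_⟩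
  have hδ0 : δ ≠ 0 := hδ.1.ne'
  have hm1 : ∀ S ∈ Icc (S₀ - 2 * ρ) (S₀ + 2 * ρ), ∀ t ∈ Icc (t₀ - 2 * ρ) (t₀ + 2 * ρ),
      S ∈ Ioo c d ∧ t ∈ Ioo u v ∧ S * h S t ∈ Metric.ball (S₀ * h S₀ t₀) ε := fun S hS t ht =>
    hmem S hS t ⟨by linarith [ht.1], by linarith [ht.2]⟩
  have hm2 : ∀ S ∈ Icc (S₀ - 2 * ρ) (S₀ + 2 * ρ), ∀ t ∈ Icc (t₀ - 2 * ρ) (t₀ + 2 * ρ),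
      S ∈ Ioo c d ∧ t + δ ∈ Ioo u v ∧ S * h S (t + δ) ∈ Metric.ball (S₀ * h S₀ t₀) ε :=
    fun S hS t ht => hmem S hS _ ⟨by linarith [ht.1, hδ.1], by linarith [ht.2, hδ.2]⟩
  have hquot : ∀ {F : ℝ → ℝ → ℝ}, ContinuousOn (uncurry F) (Ioo c d ×ˢ Ioo u v) →
      ContinuousOn (uncurry fun S t => (F S (t + δ) - F S t) / δ)
        (Icc (S₀ - 2 * ρ) (S₀ + 2 * ρ) ×ˢ Icc (t₀ - 2 * ρ) (t₀ + 2 * ρ)) := by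
    intro F hF
    have h1 : ContinuousOn (fun q : ℝ × ℝ => uncurry F (q.1, q.2 + δ))
        (Icc (S₀ - 2 * ρ) (S₀ + 2 * ρ) ×ˢ Icc (t₀ - 2 * ρ) (t₀ + 2 * ρ)) :=
      hF.comp (by fun_prop) fun q hq =>
        ⟨(hm2 _ hq.1 _ hq.2).1, (hm2 _ hq.1 _ hq.2).2.1⟩
    exact (h1.sub (hF.mono fun q hq =>
      ⟨(hm1 _ hq.1 _ hq.2).1, (hm1 _ hq.1 _ hq.2).2.1⟩)).div_const _
  have hpt : ∀ S ∈ Icc (S₀ - 2 * ρ) (S₀ + 2 * ρ), ∀ t ∈ Icc (t₀ - 2 * ρ) (t₀ + 2 * ρ),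
      (S₀ - 2 * ρ) ^ 2 * (|b₀| / 2) * ((h S (t + δ) - h S t) / δ) ^ 2 -
        K * (|(p S (t + δ) - p S t) / δ| + |(V S (t + δ) - V S t) / δ|) *
          |(h S (t + δ) - h S t) / δ| ≤
        -s * ((W S (t + δ) - W S t) / δ * ((h S (t + δ) - h S t) / δ)) ∧
      |(W S (t + δ) - W S t) / δ| ≤ K * (|(h S (t + δ) - h S t) / δ| +
        |(p S (t + δ) - p S t) / δ| + |(V S (t + δ) - V S t) / δ|) := by
    intro S hS t ht
    obtain ⟨x1, x2, x3⟩ := hm1 S hS t ht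
    obtain ⟨y1, y2, y3⟩ := hm2 S hS t ht
    obtain ⟨ξ, hξ, he⟩ := exists_deriv_eq_of_convex (f' := deriv β)
      (convex_ball (S₀ * h S₀ t₀) ε).ordConnected (fun x _ => hβ1 x) x3 y3
    refine quotient_pointwise hs1 hS₁ hS.1 hS.2 (by positivity) (hball ξ hξ).1 (hball ξ hξ).2
      (by linarith) (by linarith) ?_
    rw [hs.pde S y1 _ y2, hs.pde S x1 _ x2]
    field_simp
    linear_combination (-S) * he
  have hmain := hC (-s) (fun S t => (V S (t + δ) - V S t) / δ)
    (fun S t => (p S (t + δ) - p S t) / δ)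
    (fun S t => (h S (t + δ) - h S t) / δ) (fun S t => (W S (t + δ) - W S t) / δ)
    (by rw [abs_neg, hs1]) (hquot hVc) (hquot hpc) (hquot hh) (hquot hWc)
    (fun S hS t ht => ((hs.V_S S (hm2 S hS t ht).1 _ (hm2 S hS t ht).2.1).sub
      (hs.V_S S (hm1 S hS t ht).1 _ (hm1 S hS t ht).2.1)).div_const δ)
    (fun S hS t ht => ((hs.p_S S (hm2 S hS t ht).1 _ (hm2 S hS t ht).2.1).sub
      (hs.p_S S (hm1 S hS t ht).1 _ (hm1 S hS t ht).2.1)).div_const δ)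
    (fun S hS t ht => (((hs.V_t S (hm2 S hS t ht).1 _ (hm2 S hS t ht).2.1).comp_add_const t δ).sub
      (hs.V_t S (hm1 S hS t ht).1 _ (hm1 S hS t ht).2.1)).div_const δ)
    (fun S hS t ht => (hpt S hS t ht).1) (fun S hS t ht => (hpt S hS t ht).2)
    (fun S hS t ht => by
      obtain ⟨ξ, hξ, he⟩ := exists_deriv_eq_sub (f := V S) (f' := W S) (a := t) (b := t + δ)
        (by linarith [hδ.1]) fun τ hτ => hs.V_t S (hm1 S hS t ht).1 τ
          (hmem S hS τ ⟨by linarith [hτ.1, ht.1], by linarith [hτ.2, ht.2, hδ.2]⟩).2.1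
      have hξ' := hK₀ S hS ξ ⟨by linarith [hξ.1, ht.1], by linarith [hξ.2, ht.2, hδ.2]⟩
      rw [he, add_sub_cancel_left, mul_div_assoc, div_self hδ0, mul_one]
      linarith)
  have hsubS : Icc (S₀ - ρ) (S₀ + ρ) ⊆ Icc (S₀ - 2 * ρ) (S₀ + 2 * ρ) :=
    Icc_subset_Icc (by linarith) (by linarith)
  have hsubt : Icc (t₀ - ρ) (t₀ + ρ) ⊆ Icc (t₀ - 2 * ρ) (t₀ + 2 * ρ) :=
    Icc_subset_Icc (by linarith) (by linarith)
  have hD := hquot hh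
  set D : ℝ → ℝ → ℝ := fun S t => (h S (t + δ) - h S t) / δ with hDdef
  set ω : ℝ → ℝ → ℝ := fun S t => (((t - (t₀ - 2 * ρ)) * (t₀ + 2 * ρ - t)) *
    ((S - (S₀ - 2 * ρ)) * (S₀ + 2 * ρ - S)) ^ 2 * D S t) ^ 2 with hω
  have hωc : ContinuousOn (uncurry ω)
      (Icc (S₀ - 2 * ρ) (S₀ + 2 * ρ) ×ˢ Icc (t₀ - 2 * ρ) (t₀ + 2 * ρ)) := by
    have h0 : Continuous fun q : ℝ × ℝ => ((q.2 - (t₀ - 2 * ρ)) * (t₀ + 2 * ρ - q.2)) *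
      ((q.1 - (S₀ - 2 * ρ)) * (S₀ + 2 * ρ - q.1)) ^ 2 := by fun_prop
    exact (h0.continuousOn.mul hD).pow 2
  have hωt := continuousOn_parametric_integral (a := t₀ - 2 * ρ) (b := t₀ + 2 * ρ)
    (by linarith) (by linarith : S₀ - 2 * ρ ≤ S₀ + 2 * ρ) hωc
  have hω0 : ∀ S t, 0 ≤ ω S t := fun S t => sq_nonneg _
  have hD2 : ContinuousOn (uncurry fun S t => D S t ^ 2)
      (Icc (S₀ - 2 * ρ) (S₀ + 2 * ρ) ×ˢ Icc (t₀ - 2 * ρ) (t₀ + 2 * ρ)) := hD.pow 2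
  have hDt := continuousOn_parametric_integral (F := fun S t => D S t ^ 2) (a := t₀ - ρ)
    (b := t₀ + ρ) (c := S₀ - ρ) (d := S₀ + ρ) (by linarith) (by linarith)
    (hD2.mono (prod_mono hsubS hsubt))
  have hcmp : ∀ S ∈ Icc (S₀ - ρ) (S₀ + ρ), ∀ t ∈ Icc (t₀ - ρ) (t₀ + ρ),
      D S t ^ 2 ≤ ω S t / ρ ^ 12 := by
    intro S hS t ht
    have g1 : ∀ {x₀ x : ℝ}, x ∈ Icc (x₀ - ρ) (x₀ + ρ) →
        ρ ^ 2 ≤ (x - (x₀ - 2 * ρ)) * (x₀ + 2 * ρ - x) := fun {x₀ x} hx => by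
      nlinarith [mul_nonneg (sub_nonneg.2 hx.1) (sub_nonneg.2 hx.2)]
    have g2 := g1 ht
    have g3 := g1 hS
    have g4 := (sq_nonneg ρ).trans g2
    rw [le_div_iff₀ (by positivity), hω]
    simp only
    rw [mul_pow _ (D S t) 2, mul_comm]
    refine mul_le_mul_of_nonneg_right ?_ (sq_nonneg _)
    calc ρ ^ 12 = (ρ ^ 2 * (ρ ^ 2) ^ 2) ^ 2 := by ring
      _ ≤ _ := by gcongr
  rw [le_div_iff₀ (by positivity), ← intervalIntegral.integral_mul_const]
  refine le_trans ?_ hmain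
  have hωint : IntervalIntegrable (fun t => ∫ S in (S₀ - 2 * ρ)..(S₀ + 2 * ρ), ω S t) volume
      (t₀ - 2 * ρ) (t₀ + 2 * ρ) :=
    (hωt.mono (uIcc_of_le (by linarith)).subset).intervalIntegrable
  have hnn : ∀ t, 0 ≤ ∫ S in (S₀ - 2 * ρ)..(S₀ + 2 * ρ), ω S t := fun t =>
    intervalIntegral.integral_nonneg (by linarith) fun S _ => hω0 S t
  calc ∫ t in (t₀ - ρ)..(t₀ + ρ), (∫ S in (S₀ - ρ)..(S₀ + ρ), D S t ^ 2) * ρ ^ 12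
      ≤ ∫ t in (t₀ - ρ)..(t₀ + ρ), ∫ S in (S₀ - 2 * ρ)..(S₀ + 2 * ρ), ω S t := by
        refine intervalIntegral.integral_mono_on (by linarith)
          (((hDt.mono (uIcc_of_le (by linarith)).subset).intervalIntegrable).mul_const _)
          (hωint.mono_set ?_) fun t ht => ?_
        · rw [uIcc_of_le (by linarith), uIcc_of_le (by linarith)]; exact hsubt
        have c1 : ContinuousOn (fun S => ω S t) (Icc (S₀ - 2 * ρ) (S₀ + 2 * ρ)) :=
          ContinuousOn.section_left hωc (hsubt ht)
        have c2 : ContinuousOn (fun S => D S t ^ 2) (Icc (S₀ - ρ) (S₀ + ρ)) :=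
          ((ContinuousOn.section_left hD (hsubt ht)).mono hsubS).pow 2
        rw [← le_div_iff₀ (by positivity), ← intervalIntegral.integral_div]
        have i1 : IntervalIntegrable (fun S => ω S t) volume (S₀ - 2 * ρ) (S₀ + 2 * ρ) :=
          (c1.mono (uIcc_of_le (by linarith)).subset).intervalIntegrable
        calc ∫ S in (S₀ - ρ)..(S₀ + ρ), D S t ^ 2
            ≤ ∫ S in (S₀ - ρ)..(S₀ + ρ), ω S t / ρ ^ 12 :=
              intervalIntegral.integral_mono_on (by linarith)
                ((c2.mono (uIcc_of_le (by linarith)).subset).intervalIntegrable)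
                (((c1.mono hsubS).div_const _).mono
                  (uIcc_of_le (by linarith)).subset).intervalIntegrable
                fun S hS => hcmp S hS t ht
          _ ≤ _ := intervalIntegral.integral_mono_interval (by linarith) (by linarith)
              (by linarith) (ae_of_all _ fun S => div_nonneg (hω0 S t) (by positivity))
              (i1.div_const _)
    _ ≤ _ := intervalIntegral.integral_mono_interval (by linarith) (by linarith)
              (by linarith) (ae_of_all _ fun t => hnn t) hωint

end

section

lemma tendsto_integral_quotient {f : ℝ → ℝ} (hf : Continuous f) {δ : ℕ → ℝ}
    (hδ0 : ∀ n, 0 < δ n) (hδ : Tendsto δ atTop (𝓝 0)) (x y : ℝ) :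
    Tendsto (fun n => ∫ t in x..y, (f (t + δ n) - f t) / δ n) atTop (𝓝 (f y - f x)) := by
  have hF := hasDerivAt_primitive hf
  set F : ℝ → ℝ := fun x => ∫ z in (0:ℝ)..x, f z with hFdef
  have hδ' : Tendsto δ atTop (𝓝[≠] 0) :=
    tendsto_nhdsWithin_iff.2 ⟨hδ, Eventually.of_forall fun n => (hδ0 n).ne'⟩
  have hs : ∀ z, Tendsto (fun n => (F (z + δ n) - F z) / δ n) atTop (𝓝 (f z)) := fun z => by
    have := (hasDerivAt_iff_tendsto_slope_zero.1 (hF z)).comp hδ'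
    refine this.congr fun n => ?_
    simp only [comp_apply, smul_eq_mul]
    ring
  refine ((hs y).sub (hs x)).congr fun n => ?_
  have hint : ∫ t in x..y, (f (t + δ n) - f t) / δ n =
      ((F (y + δ n) - F y) / δ n) - ((F (x + δ n) - F x) / δ n) :=
    intervalIntegral.integral_eq_sub_of_hasDerivAt
      (f := fun t => (F (t + δ n) - F t) / δ n)
      (fun t _ => (((hF (t + δ n)).comp_add_const t (δ n)).sub (hF t)).div_const _)
      ((by fun_prop : Continuous fun t => (f (t + δ n) - f t) / δ n).intervalIntegrable _ _)
  exact hint.symm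

/-- A continuous function whose difference quotients stay bounded in `L²` along a sequence of steps
is absolutely continuous. -/
lemma absolutelyContinuousOnInterval_of_quotient {f : ℝ → ℝ} (hf : Continuous f) {δ : ℕ → ℝ}
    (hδ0 : ∀ n, 0 < δ n) (hδ : Tendsto δ atTop (𝓝 0)) {a b M : ℝ} (hab : a ≤ b)
    (hM : ∃ᶠ n in atTop, ∫ t in a..b, ((f (t + δ n) - f t) / δ n) ^ 2 ≤ M) :
    AbsolutelyContinuousOnInterval f a b := by
  rw [absolutelyContinuousOnInterval_iff]
  intro ε hε
  set θ := ε / (4 * (|M| + 1)) with hθ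
  have hθ0 : 0 < θ := by positivity
  refine ⟨ε * θ, by positivity, ?_⟩
  rintro ⟨k, E⟩ hE hlen
  simp only at hlen ⊢
  set L := ∑ i ∈ Finset.range k, dist (E i).1 (E i).2 with hL
  have hbound : ∀ n, ∑ i ∈ Finset.range k,
      |∫ t in (E i).1..(E i).2, (f (t + δ n) - f t) / δ n| ≤
        θ * (∫ t in a..b, ((f (t + δ n) - f t) / δ n) ^ 2) + L / (4 * θ) := by
    intro n
    set D : ℝ → ℝ := fun t => (f (t + δ n) - f t) / δ n with hD
    have hDc : Continuous D := by fun_prop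
    have hint : ∀ x y, IntegrableOn (fun t => D t ^ 2) (uIoc x y) := fun x y =>
      (intervalIntegrable_iff.1 ((hDc.pow 2).intervalIntegrable x y))
    have h1 : ∀ i, |∫ t in (E i).1..(E i).2, D t| ≤
        θ * (∫ t in uIoc (E i).1 (E i).2, D t ^ 2) + dist (E i).1 (E i).2 / (4 * θ) := by
      intro i
      refine (intervalIntegral.norm_integral_le_integral_norm_uIoc
        (f := D) (μ := volume)).trans ?_
      have hc : IntegrableOn (fun _ : ℝ => 1 / (4 * θ)) (uIoc (E i).1 (E i).2) :=
        intervalIntegrable_iff.1 (by simp)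
      calc ∫ t in uIoc (E i).1 (E i).2, ‖D t‖
          ≤ ∫ t in uIoc (E i).1 (E i).2, (θ * D t ^ 2 + 1 / (4 * θ)) := by
            refine integral_mono (intervalIntegrable_iff.1 (hDc.norm.intervalIntegrable _ _))
              (((hint _ _).const_mul θ).add hc) fun t => ?_
            have : θ * D t ^ 2 + 1 / (4 * θ) - |D t| = (2 * θ * |D t| - 1) ^ 2 / (4 * θ) := by
              rw [← sq_abs (D t)]; field_simp; ring
            have h0 : 0 ≤ (2 * θ * |D t| - 1) ^ 2 / (4 * θ) := by positivity
            simp only [Real.norm_eq_abs]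
            linarith
        _ = _ := by
            rw [integral_add ((hint _ _).const_mul θ) hc, integral_const_mul,
              setIntegral_const]
            simp only [Measure.real, volume_uIoc, smul_eq_mul, Real.dist_eq]
            rw [ENNReal.toReal_ofReal (abs_nonneg _), abs_sub_comm]
            ring
    refine (Finset.sum_le_sum fun i _ => h1 i).trans ?_
    rw [Finset.sum_add_distrib, ← Finset.mul_sum, ← Finset.sum_div]
    gcongr
    rw [← integral_biUnion_finset _ (fun i _ => measurableSet_uIoc) hE.2 fun i _ => hint _ _,
      intervalIntegral.integral_of_le hab]
    refine setIntegral_mono_set ?_ (ae_of_all _ fun t => sq_nonneg _)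
      (Eventually.of_forall ?_)
    · simpa [uIoc_of_le hab] using hint a b
    · have := AbsolutelyContinuousOnInterval.biUnion_uIoc_subset_of_mem_disjWithin hE
      rwa [uIoc_of_le hab] at this
  have hlim : Tendsto (fun n => ∑ i ∈ Finset.range k,
      |∫ t in (E i).1..(E i).2, (f (t + δ n) - f t) / δ n|) atTop
      (𝓝 (∑ i ∈ Finset.range k, |f (E i).2 - f (E i).1|)) :=
    tendsto_finsetSum _ fun i _ => (tendsto_integral_quotient hf hδ0 hδ _ _).abs
  have hle : ∑ i ∈ Finset.range k, |f (E i).2 - f (E i).1| ≤ θ * |M| + L / (4 * θ) := by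
    by_contra! hcon
    obtain ⟨n, h1, h2⟩ := (hM.and_eventually (hlim.eventually (lt_mem_nhds hcon))).exists
    have := hbound n
    have h3 : θ * (∫ t in a..b, ((f (t + δ n) - f t) / δ n) ^ 2) ≤ θ * |M| := by
      gcongr; exact h1.trans (le_abs_self M)
    linarith
  have e1 : θ * |M| ≤ ε / 4 := by
    rw [hθ, div_mul_eq_mul_div, div_le_div_iff₀ (by positivity) (by norm_num)]
    nlinarith [abs_nonneg M]
  have e2 : L / (4 * θ) ≤ ε / 4 := by
    rw [div_le_div_iff₀ (by positivity) (by norm_num)]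
    linarith
  calc ∑ i ∈ Finset.range k, dist (f (E i).1) (f (E i).2)
      = ∑ i ∈ Finset.range k, |f (E i).2 - f (E i).1| :=
        Finset.sum_congr rfl fun i _ => by rw [Real.dist_eq, abs_sub_comm]
    _ < ε := by linarith

lemma ae_exists_frequently_le {g : ℕ → ℝ → ℝ} (hg : ∀ n, Continuous (g n))
    (hg0 : ∀ n x, 0 ≤ g n x) {c d C : ℝ} (hcd : c ≤ d) (hC : ∀ n, ∫ x in c..d, g n x ≤ C) :
    ∀ᵐ x ∂(volume.restrict (Ioc c d)), ∃ M, ∃ᶠ n in atTop, g n x ≤ M := by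
  have hm : ∀ n, Measurable fun x => ENNReal.ofReal (g n x) := fun n =>
    (hg n).measurable.ennreal_ofReal
  have h1 : ∀ n, ∫⁻ x in Ioc c d, ENNReal.ofReal (g n x) ≤ ENNReal.ofReal C := fun n => by
    rw [← ofReal_integral_eq_lintegral_ofReal _ (ae_of_all _ (hg0 n)),
      ← intervalIntegral.integral_of_le hcd]
    · exact ENNReal.ofReal_le_ofReal (hC n)
    · exact (intervalIntegrable_iff_integrableOn_Ioc_of_le hcd).1 ((hg n).intervalIntegrable _ _)
  have h2 : ∫⁻ x in Ioc c d, liminf (fun n => ENNReal.ofReal (g n x)) atTop ≠ ⊤ := by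
    refine ne_top_of_le_ne_top ENNReal.ofReal_ne_top
      ((lintegral_liminf_le hm).trans (b := liminf (fun n => ∫⁻ x in Ioc c d,
        ENNReal.ofReal (g n x)) atTop) (c := ENNReal.ofReal C) ?_)
    exact (liminf_le_liminf (Eventually.of_forall h1)).trans_eq (liminf_const _)
  filter_upwards [ae_lt_top (Measurable.liminf hm) h2] with x hx
  obtain ⟨M, hM1, hM2⟩ := exists_between hx
  refine ⟨M.toReal, (frequently_lt_of_liminf_lt (by isBoundedDefault) hM1).mono fun n hn => ?_⟩
  exact (ENNReal.ofReal_le_iff_le_toReal hM2.ne).1 hn.le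

end

section

variable {r : ℝ} {β : ℝ → ℝ} {V p h l W γ : ℝ → ℝ → ℝ} {J I : Set ℝ}

lemma hasDerivAt_time_primitive (hγ : Continuous (uncurry γ)) (S t : ℝ) :
    HasDerivAt (fun t => ∫ τ in (0:ℝ)..t, γ S τ) (γ S t) t :=
  hasDerivAt_primitive (hγ.comp (Continuous.prodMk_right S)) t

lemma continuous_time_primitive (hγ : Continuous (uncurry γ)) :
    Continuous (uncurry fun S t => ∫ τ in (0:ℝ)..t, γ S τ) :=
  (continuous_uncurry_primitive (F := fun t S => γ S t) (hγ.comp continuous_swap)).comp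
    continuous_swap

/-- An absolutely continuous function whose junk-valued derivative is continuous is, up to a
constant, the primitive of that derivative. -/
lemma const_of_absolutelyContinuous {f k g : ℝ → ℝ} {a b : ℝ}
    (hf : AbsolutelyContinuousOnInterval f a b) (hg : Continuous g) (hab : a ≤ b)
    (hfk : ∀ t ∈ Icc a b, f t = k t) (hk : ∀ t ∈ Ioo a b, deriv k t = g t) :
    ∀ s ∈ Icc a b, ∀ t ∈ Icc a b,
      k s - ∫ τ in (0:ℝ)..s, g τ = k t - ∫ τ in (0:ℝ)..t, g τ := by
  have hG : AbsolutelyContinuousOnInterval (fun t => ∫ τ in (0:ℝ)..t, g τ) a b := by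
    refine ContDiffOn.absolutelyContinuousOnInterval (ContDiff.contDiffOn ?_)
    refine contDiff_one_iff_deriv.2 ⟨fun t => (hasDerivAt_primitive hg t).differentiableAt, ?_⟩
    rwa [funext fun t => (hasDerivAt_primitive hg t).deriv]
  have hd : ∀ᵐ t : ℝ, t ∈ uIcc a b →
      HasDerivAt (f - fun t => ∫ τ in (0:ℝ)..t, g τ) 0 t := by
    filter_upwards [hf.ae_differentiableAt, Measure.ae_ne volume a, Measure.ae_ne volume b]
      with t h1 h2 h3 ht
    have ht' : t ∈ Ioo a b := by
      rw [uIcc_of_le hab] at ht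
      exact ⟨lt_of_le_of_ne ht.1 (Ne.symm h2), lt_of_le_of_ne ht.2 h3⟩
    have he : f =ᶠ[𝓝 t] k := by
      filter_upwards [isOpen_Ioo.mem_nhds ht'] with w hw using hfk w (Ioo_subset_Icc_self hw)
    have h4 := (h1 ht).hasDerivAt
    rw [he.deriv_eq, hk t ht'] at h4
    simpa using h4.sub (hasDerivAt_primitive hg t)
  obtain ⟨C, hC⟩ := (hf.sub hG).const_of_ae_hasDerivAt_zero hd
  rw [uIcc_of_le hab] at hC
  intro s hs t ht
  have h1 := hC s hs
  have h2 := hC t ht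
  simp only [Pi.sub_apply] at h1 h2
  rw [← hfk s hs, ← hfk t ht, h1, h2]

/-- Near a point where the equation is not degenerate, the defect is constant in time. -/
lemma SeparateSolution.defectConstant_of_nondegenerate {c d u v : ℝ}
    (hs : SeparateSolution r β V p h l W γ (Ioo c d) (Ioo u v)) (hβ : ContDiff ℝ 2 β)
    (hh : ContinuousOn (uncurry h) (Ioo c d ×ˢ Ioo u v)) {S₀ t₀ : ℝ} (hS₀ : S₀ ∈ Ioo c d)
    (ht₀ : t₀ ∈ Ioo u v) (ha : deriv β (S₀ * h S₀ t₀) ≠ 0) :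
    ∃ ρ > 0, Ioo (S₀ - ρ) (S₀ + ρ) ⊆ Ioo c d ∧ Ioo (t₀ - ρ) (t₀ + ρ) ⊆ Ioo u v ∧
      DefectConstant h γ (Ioo (S₀ - ρ) (S₀ + ρ)) (Ioo (t₀ - ρ) (t₀ + ρ)) := by
  obtain ⟨ρ, hρ, hJ, hI, C, hC⟩ := hs.exists_quotient_bound hβ hh hS₀ ht₀ ha
  have hI' : Icc (t₀ - ρ) (t₀ + ρ) ⊆ Ioo u v :=
    (Icc_subset_Icc (by linarith) (by linarith)).trans hI
  refine ⟨ρ, hρ, Ioo_subset_Icc_self.trans hJ, Ioo_subset_Icc_self.trans hI', ?_⟩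
  obtain ⟨k, hkc, hk⟩ := exists_continuous_extension (by linarith) (by linarith)
    (hh.mono (prod_mono hJ hI))
  set δ : ℕ → ℝ := fun n => ρ / (n + 2) with hδ
  have hδ0 : ∀ n, 0 < δ n := fun n => by positivity
  have hδ1 : ∀ n, δ n < ρ := fun n => by
    refine div_lt_self hρ ?_
    have : (0:ℝ) ≤ n := n.cast_nonneg
    linarith
  have hδt : Tendsto δ atTop (𝓝 0) :=
    tendsto_const_nhds.div_atTop
      (tendsto_atTop_add_const_right _ _ tendsto_natCast_atTop_atTop)
  have hqc : ∀ n, Continuous (uncurry fun S t => ((k S (t + δ n) - k S t) / δ n) ^ 2) := fun n => by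
    have h1 : Continuous fun q : ℝ × ℝ => k q.1 (q.2 + δ n) :=
      hkc.comp (by fun_prop : Continuous fun q : ℝ × ℝ => (q.1, q.2 + δ n))
    exact ((h1.sub hkc).div_const _).pow 2
  set g : ℕ → ℝ → ℝ := fun n S => ∫ t in (t₀ - ρ)..(t₀ + ρ),
    ((k S (t + δ n) - k S t) / δ n) ^ 2 with hg
  have hgc : ∀ n, Continuous (g n) := fun n =>
    intervalIntegral.continuous_parametric_intervalIntegral_of_continuous' (hqc n) _ _
  have hg0 : ∀ n x, 0 ≤ g n x := fun n x =>
    intervalIntegral.integral_nonneg (by linarith) fun t _ => sq_nonneg _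
  have hgC : ∀ n, ∫ S in (S₀ - ρ)..(S₀ + ρ), g n S ≤ C := fun n => by
    simp only [hg]
    rw [intervalIntegral_intervalIntegral_swap (((hqc n).continuousOn.integrableOn_compact
      (isCompact_uIcc.prod isCompact_uIcc)).mono_set
      (prod_mono uIoc_subset_uIcc uIoc_subset_uIcc))]
    refine (intervalIntegral.integral_congr fun t ht => ?_).trans_le (hC (δ n) ⟨hδ0 n, hδ1 n⟩)
    refine intervalIntegral.integral_congr fun S hS => ?_
    rw [uIcc_of_le (by linarith)] at ht hS
    have := hδ0 n
    have := hδ1 n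
    rw [hk S hS _ ⟨by linarith [ht.1], by linarith [ht.2]⟩,
      hk S hS _ ⟨by linarith [ht.1], by linarith [ht.2]⟩]
  have hae := ae_exists_frequently_le hgc hg0 (by linarith) hgC
  have hslice : ∀ᵐ S ∂(volume.restrict (Ioo (S₀ - ρ) (S₀ + ρ))),
      ∀ s ∈ Icc (t₀ - ρ) (t₀ + ρ), ∀ t ∈ Icc (t₀ - ρ) (t₀ + ρ),
        defect h γ S s = defect h γ S t := by
    filter_upwards [ae_restrict_of_ae_restrict_of_subset Ioo_subset_Ioc_self hae,
      ae_restrict_mem measurableSet_Ioo] with S hM hS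
    obtain ⟨M, hM⟩ := hM
    exact const_of_absolutelyContinuous (absolutelyContinuousOnInterval_of_quotient
      (hkc.comp (Continuous.prodMk_right S)) hδ0 hδt (by linarith) hM)
      (hs.γ_cont.comp (Continuous.prodMk_right S)) (by linarith)
      (fun t ht => hk S (Ioo_subset_Icc_self hS) t ⟨by linarith [ht.1], by linarith [ht.2]⟩)
      fun t ht => hs.γ_eq S (hJ (Ioo_subset_Icc_self hS)) t (hI' (Ioo_subset_Icc_self ht))
  have hdc : ∀ t ∈ Ioo u v, ContinuousOn (fun S => defect h γ S t) (Ioo (S₀ - ρ) (S₀ + ρ)) :=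
    fun t ht S hS => ((hs.h_S S (hJ (Ioo_subset_Icc_self hS)) t ht).continuousAt.sub
      ((continuous_time_primitive hs.γ_cont).comp
        (Continuous.prodMk_left t)).continuousAt).continuousWithinAt
  intro S hS s hs' t ht
  refine Measure.eqOn_open_of_ae_eq (μ := volume) ?_ isOpen_Ioo
    (hdc s (hI' (Ioo_subset_Icc_self hs'))) (hdc t (hI' (Ioo_subset_Icc_self ht))) hS
  filter_upwards [hslice] with x hx
    using hx s (Ioo_subset_Icc_self hs') t (Ioo_subset_Icc_self ht)

end

section

lemma exists_isGreatest_zero {a : ℝ → ℝ} {x y : ℝ} (hxy : x ≤ y) (ha : ContinuousOn a (Icc x y))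
    (hx : a x = 0) : ∃ z, IsGreatest {w ∈ Icc x y | a w = 0} z :=
  (isCompact_Icc.of_isClosed_subset
    (ha.preimage_isClosed_of_isClosed isClosed_Icc (isClosed_singleton (x := (0:ℝ))))
    inter_subset_left).exists_isGreatest ⟨x, left_mem_Icc.2 hxy, hx⟩

lemma exists_isLeast_zero {a : ℝ → ℝ} {x y : ℝ} (hxy : x ≤ y) (ha : ContinuousOn a (Icc x y))
    (hy : a y = 0) : ∃ z, IsLeast {w ∈ Icc x y | a w = 0} z :=
  (isCompact_Icc.of_isClosed_subset
    (ha.preimage_isClosed_of_isClosed isClosed_Icc (isClosed_singleton (x := (0:ℝ))))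
    inter_subset_left).exists_isLeast ⟨y, right_mem_Icc.2 hxy, hy⟩

/-- One-sided version of `deriv_eq_of_zero_set`. -/
lemma deriv_eq_of_zero_set_right {Y φ a : ℝ → ℝ} {c d p Y' : ℝ} (hp : p ∈ Ioo c d)
    (hY : HasDerivAt Y Y' p) (hc : ContinuousOn Y (Ioo c d)) (ha : ContinuousOn a (Ioo c d))
    (hφ : ContinuousAt φ p) (hz : ∀ S ∈ Ioo c d, a S = 0 → Y S = 0)
    (hd : ∀ S ∈ Ioo c d, a S ≠ 0 → HasDerivAt Y (φ S) S) (hap : a p = 0)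
    (hf : ∃ᶠ S in 𝓝[>] p, a S ≠ 0) : Y' = φ p := by
  have hYp := hz p hp hap
  have hsub : ∀ {x y}, p ≤ x → y < d → Icc x y ⊆ Ioo c d := fun hx hy w hw =>
    ⟨hp.1.trans_le (hx.trans hw.1), hw.2.trans_lt hy⟩
  have hback : ∀ S ∈ Ioo p d, a S ≠ 0 →
      ∃ z ∈ Ico p S, a z = 0 ∧ ∃ ξ ∈ Ioo z S, Y S = φ ξ * (S - z) := by
    intro S hS haS
    obtain ⟨z, ⟨hz1, hz2⟩, hz3⟩ := exists_isGreatest_zero hS.1.le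
      (ha.mono (hsub le_rfl hS.2)) hap
    have hzS : z < S := lt_of_le_of_ne hz1.2 fun he => haS (he ▸ hz2)
    refine ⟨z, ⟨hz1.1, hzS⟩, hz2, ?_⟩
    obtain ⟨ξ, hξ, he⟩ := exists_hasDerivAt_eq_slope Y φ hzS (hc.mono (hsub hz1.1 hS.2))
      fun w hw => hd w (hsub hz1.1 hS.2 (Ioo_subset_Icc_self hw)) fun h0 =>
        hw.1.not_ge (hz3 ⟨⟨hz1.1.trans hw.1.le, hw.2.le⟩, h0⟩)
    refine ⟨ξ, hξ, ?_⟩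
    rw [he, hz z (hsub le_rfl (hzS.trans hS.2) ⟨hz1.1, le_rfl⟩) hz2, sub_zero,
      div_mul_cancel₀ _ (sub_pos.2 hzS).ne']
  have hslope : Tendsto (slope Y p) (𝓝[>] p) (𝓝 Y') :=
    (hasDerivAt_iff_tendsto_slope.1 hY).mono_left (nhdsWithin_mono _ fun x hx => ne_of_gt hx)
  have hslope' : ∀ S, slope Y p S = Y S / (S - p) := fun S => by
    rw [slope_def_field, hYp, sub_zero]
  by_contra hne
  have hε : 0 < |Y' - φ p| := abs_pos.2 (sub_ne_zero.2 hne)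
  by_cases h0 : φ p = 0
  · rw [h0, sub_zero] at hε
    have h1 : ∀ᶠ S in 𝓝 p, |φ S| < |Y'| / 2 :=
      (hφ.abs).eventually (gt_mem_nhds (by simpa [h0] using hε))
    obtain ⟨η, hη, hη'⟩ := Metric.eventually_nhds_iff.1 h1
    have h2 : ∀ᶠ S in 𝓝[>] p, |Y'| / 2 < |slope Y p S| :=
      hslope.abs.eventually (lt_mem_nhds (by linarith))
    obtain ⟨S, haS, hS2, hS3⟩ := (hf.and_eventually (h2.and
      (Ioo_mem_nhdsGT (lt_min hp.2 (by linarith : p < p + η))))).exists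
    have hSd : S < d := hS3.2.trans_le (min_le_left _ _)
    have hSη : S < p + η := hS3.2.trans_le (min_le_right _ _)
    obtain ⟨z, hz1, -, ξ, hξ, he⟩ := hback S ⟨hS3.1, hSd⟩ haS
    have hSp : 0 < S - p := sub_pos.2 hS3.1
    rw [hslope', abs_div, abs_of_pos hSp, lt_div_iff₀ hSp, he, abs_mul,
      abs_of_pos (sub_pos.2 hz1.2)] at hS2
    have h3 := hη' (y := ξ) (by
      rw [Real.dist_eq, abs_of_pos (by linarith [hξ.1, hz1.1])]; linarith [hξ.2])
    nlinarith [abs_nonneg (φ ξ), hz1.1, hz1.2, mul_nonneg (abs_nonneg (φ ξ)) (sub_nonneg.2 hz1.1)]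
  · have h1 : ∀ᶠ S in 𝓝 p, φ S ≠ 0 := hφ.eventually_ne h0
    obtain ⟨η, hη, hη'⟩ := Metric.eventually_nhds_iff.1 h1
    have hnz : ∀ S ∈ Ioo p (min d (p + η)), a S ≠ 0 := by
      intro S hS haS
      have hSd : S < d := hS.2.trans_le (min_le_left _ _)
      have hSη : S < p + η := hS.2.trans_le (min_le_right _ _)
      obtain ⟨w, haw, hw⟩ := (hf.and_eventually (Ioo_mem_nhdsGT hS.1)).exists
      obtain ⟨z, hz1, hz2, -⟩ := hback w ⟨hw.1, hw.2.trans hSd⟩ haw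
      obtain ⟨z, ⟨hz1, hz2⟩, hz3⟩ := exists_isGreatest_zero hw.1.le
        (ha.mono (hsub le_rfl (hw.2.trans hSd))) hap
      obtain ⟨y, ⟨hy1, hy2⟩, hy3⟩ := exists_isLeast_zero hw.2.le
        (ha.mono (hsub hw.1.le hSd)) haS
      have hzw : z < w := lt_of_le_of_ne hz1.2 fun he => haw (he ▸ hz2)
      have hwy : w < y := lt_of_le_of_ne hy1.1 fun he => haw (he ▸ hy2)
      have hyd : y < d := hy1.2.trans_lt hSd
      obtain ⟨ξ, hξ, he⟩ := exists_hasDerivAt_eq_zero (f := Y) (f' := φ) (hzw.trans hwy)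
        (hc.mono (hsub hz1.1 hyd))
        (by rw [hz z (hsub hz1.1 hyd ⟨le_rfl, (hzw.trans hwy).le⟩) hz2,
          hz y (hsub hz1.1 hyd ⟨(hzw.trans hwy).le, le_rfl⟩) hy2])
        fun x hx => hd x (hsub hz1.1 hyd (Ioo_subset_Icc_self hx)) fun h0 => by
          rcases le_total x w with hxw | hxw
          · exact hx.1.not_ge (hz3 ⟨⟨hz1.1.trans hx.1.le, hxw⟩, h0⟩)
          · exact hx.2.not_ge (hy3 ⟨⟨hxw, hx.2.le.trans hy1.2⟩, h0⟩)
      refine hη' (y := ξ) ?_ he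
      rw [Real.dist_eq, abs_of_pos (by linarith [hξ.1, hz1.1])]
      linarith [hξ.2, hy1.2]
    have h2 : ∀ᶠ S in 𝓝 p, |φ S - φ p| < |Y' - φ p| / 2 := by
      have := (hφ.sub_const (φ p)).abs
      exact this.eventually (gt_mem_nhds (by simpa using hε))
    obtain ⟨κ, hκ, hκ'⟩ := Metric.eventually_nhds_iff.1 h2
    have h3 : ∀ᶠ S in 𝓝[>] p, |Y' - φ p| / 2 < |slope Y p S - φ p| :=
      (hslope.sub_const (φ p)).abs.eventually (lt_mem_nhds (by linarith))
    have h4 : ∀ᶠ S in 𝓝[>] p, S ∈ Ioo p (min d (p + η)) :=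
      Ioo_mem_nhdsGT (lt_min hp.2 (by linarith))
    have h5 : ∀ᶠ S in 𝓝[>] p, S ∈ Ioo p (p + κ) := Ioo_mem_nhdsGT (by linarith)
    obtain ⟨S, hS1, hS2, hS3⟩ := (h3.and (h4.and h5)).exists
    have hSd : S < d := hS2.2.trans_le (min_le_left _ _)
    obtain ⟨z, hz1, hz2, ξ, hξ, he⟩ := hback S ⟨hS2.1, hSd⟩ (hnz S hS2)
    have hzp : z = p := by
      by_contra hzp
      exact hnz z ⟨lt_of_le_of_ne hz1.1 (Ne.symm hzp), hz1.2.trans hS2.2⟩ hz2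
    subst hzp
    rw [hslope', he, mul_div_cancel_right₀ _ (sub_pos.2 hS2.1).ne'] at hS1
    have := hκ' (y := ξ) (by
      rw [Real.dist_eq, abs_of_pos (by linarith [hξ.1])]; linarith [hξ.2, hS3.2])
    linarith

/-- Let `Y` vanish where `a` vanishes and have derivative `φ` elsewhere. At a zero of `a` which is
a limit of points where `a ≠ 0`, the derivative of `Y`, if it exists, equals `φ`. -/
lemma deriv_eq_of_zero_set {Y φ a : ℝ → ℝ} {c d p Y' : ℝ} (hp : p ∈ Ioo c d)
    (hY : HasDerivAt Y Y' p) (hc : ContinuousOn Y (Ioo c d)) (ha : ContinuousOn a (Ioo c d))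
    (hφ : ContinuousAt φ p) (hz : ∀ S ∈ Ioo c d, a S = 0 → Y S = 0)
    (hd : ∀ S ∈ Ioo c d, a S ≠ 0 → HasDerivAt Y (φ S) S) (hap : a p = 0)
    (hf : ∃ᶠ S in 𝓝 p, a S ≠ 0) : Y' = φ p := by
  have hf' : ∃ᶠ S in 𝓝[<] p ⊔ 𝓝[>] p, a S ≠ 0 := by
    rw [nhdsLT_sup_nhdsGT p]
    rw [frequently_nhdsWithin_iff]
    exact hf.mono fun S hS => ⟨hS, fun h0 => hS (h0 ▸ hap)⟩
  rcases frequently_sup.1 hf' with hf' | hf'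
  · have hm : MapsTo (fun x : ℝ => -x) (Ioo (-d) (-c)) (Ioo c d) := fun x hx =>
      ⟨by linarith [hx.2], by linarith [hx.1]⟩
    have h := deriv_eq_of_zero_set_right (Y := fun x => Y (-x)) (φ := fun x => -φ (-x))
      (a := fun x => a (-x)) (c := -d) (d := -c) (p := -p) (Y' := -Y')
      ⟨neg_lt_neg hp.2, neg_lt_neg hp.1⟩
      (by
        have h1 : HasDerivAt Y Y' (-(-p)) := by rwa [neg_neg]
        simpa [comp_def] using h1.comp (-p) (hasDerivAt_neg (-p)))
      (hc.comp continuous_neg.continuousOn hm) (ha.comp continuous_neg.continuousOn hm)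
      (ContinuousAt.comp (x := -p) (by rwa [neg_neg] : ContinuousAt φ (-(-p)))
        continuous_neg.continuousAt).neg
      (fun S hS h0 => hz (-S) (hm hS) h0)
      (fun S hS h0 => by simpa [comp_def] using (hd (-S) (hm hS) h0).comp S (hasDerivAt_neg S))
      (by simpa using hap)
      (by
        have ht : Tendsto (fun x : ℝ => -x) (𝓝[<] p) (𝓝[>] (-p)) := tendsto_neg_nhdsLT
        exact ht.frequently (hf'.mono fun x hx => by simpa using hx))
    simpa using h
  · exact deriv_eq_of_zero_set_right hp hY hc ha hφ hz hd hap hf'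

lemma hasDerivAt_mul_of_continuousAt {f g : ℝ → ℝ} {f' x : ℝ} (hf : HasDerivAt f f' x)
    (hfx : f x = 0) (hg : ContinuousAt g x) : HasDerivAt (fun y => f y * g y) (f' * g x) x := by
  rw [hasDerivAt_iff_tendsto_slope] at hf ⊢
  refine (hf.mul (hg.tendsto.mono_left nhdsWithin_le_nhds)).congr fun y => ?_
  simp only [slope_def_field, hfx]
  ring

end

section

variable {r : ℝ} {β : ℝ → ℝ} {V p h l W γ : ℝ → ℝ → ℝ} {J I : Set ℝ} {c d u v : ℝ}

/-- The defect is constant in time on some rectangle around `(S₀, t₀)` inside `J × I`. -/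
def LocallyDefectConstant (h γ : ℝ → ℝ → ℝ) (J I : Set ℝ) (S₀ t₀ : ℝ) : Prop :=
  ∃ ρ > 0, Ioo (S₀ - ρ) (S₀ + ρ) ⊆ J ∧ Ioo (t₀ - ρ) (t₀ + ρ) ⊆ I ∧
    DefectConstant h γ (Ioo (S₀ - ρ) (S₀ + ρ)) (Ioo (t₀ - ρ) (t₀ + ρ))

namespace SeparateSolution

lemma hasDerivAt_flux_of_locally
    (hs : SeparateSolution r β V p h l W γ (Ioo c d) (Ioo u v)) (hβ : ContDiff ℝ 2 β) {S₀ t₀ : ℝ}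
    (hd : LocallyDefectConstant h γ (Ioo c d) (Ioo u v) S₀ t₀) :
    HasDerivAt (fun S => flux r β h l S t₀) (γ S₀ t₀) S₀ := by
  obtain ⟨ρ, hρ, hJ, hI, hd⟩ := hd
  exact (hs.mono hJ hI).hasDerivAt_flux_of_defectConstant hβ hd S₀ ⟨by linarith, by linarith⟩ t₀
    ⟨by linarith, by linarith⟩

lemma locallyDefectConstant_of_differentiable
    (hs : SeparateSolution r β V p h l W γ (Ioo c d) (Ioo u v)) {S₀ t₀ : ℝ}
    (hS₀ : S₀ ∈ Ioo c d) (ht₀ : t₀ ∈ Ioo u v)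
    (hd : ∀ᶠ q in 𝓝 (S₀, t₀), DifferentiableAt ℝ (h q.1) q.2) :
    LocallyDefectConstant h γ (Ioo c d) (Ioo u v) S₀ t₀ := by
  obtain ⟨ρ, hρ, hsub⟩ := exists_rect_subset (inter_mem hd
    ((isOpen_Ioo.prod isOpen_Ioo).mem_nhds (mk_mem_prod hS₀ ht₀)))
  have hmem : ∀ S ∈ Ioo (S₀ - ρ) (S₀ + ρ), ∀ t ∈ Ioo (t₀ - ρ) (t₀ + ρ),
      DifferentiableAt ℝ (h S) t ∧ S ∈ Ioo c d ∧ t ∈ Ioo u v := fun S hS t ht =>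
    hsub (mk_mem_prod (Ioo_subset_Icc_self hS) (Ioo_subset_Icc_self ht))
  refine ⟨ρ, hρ, fun S hS => (hmem S hS t₀ ⟨by linarith, by linarith⟩).2.1,
    fun t ht => (hmem S₀ ⟨by linarith, by linarith⟩ t ht).2.2, fun S hS =>
    eq_of_hasDerivAt_zero fun t ht => ?_⟩
  obtain ⟨h1, h2, h3⟩ := hmem S hS t ht
  have h4 := h1.hasDerivAt
  rw [hs.γ_eq S h2 t h3] at h4
  exact (h4.sub (hasDerivAt_time_primitive hs.γ_cont S t)).congr_deriv (sub_self _)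

lemma locallyDefectConstant_of_ne_zero
    (hs : SeparateSolution r β V p h l W γ (Ioo c d) (Ioo u v)) {S₀ t₀ : ℝ}
    (hS₀ : S₀ ∈ Ioo c d) (ht₀ : t₀ ∈ Ioo u v) (hγ : γ S₀ t₀ ≠ 0) :
    LocallyDefectConstant h γ (Ioo c d) (Ioo u v) S₀ t₀ := by
  refine hs.locallyDefectConstant_of_differentiable hS₀ ht₀ ?_
  filter_upwards [hs.γ_cont.continuousAt.eventually_ne hγ,
    (isOpen_Ioo.prod isOpen_Ioo).mem_nhds (mk_mem_prod hS₀ ht₀)] with q hq hq'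
  exact differentiableAt_of_deriv_ne_zero (by rwa [hs.γ_eq q.1 hq'.1 q.2 hq'.2])

lemma hasStrictFDerivAt_V (hs : SeparateSolution r β V p h l W γ (Ioo c d) (Ioo u v))
    (hβ : Continuous β) (hh : ContinuousOn (uncurry h) (Ioo c d ×ˢ Ioo u v)) {S t : ℝ}
    (hS : S ∈ Ioo c d) (ht : t ∈ Ioo u v) :
    HasStrictFDerivAt (uncurry V) ((ContinuousLinearMap.toSpanSingleton ℝ (p S t)).coprod
      (ContinuousLinearMap.toSpanSingleton ℝ (W S t))) (S, t) := by
  obtain ⟨hp, -, hW⟩ := hs.continuousOn_W hβ hh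
  have hn : Ioo c d ×ˢ Ioo u v ∈ 𝓝 (S, t) :=
    (isOpen_Ioo.prod isOpen_Ioo).mem_nhds (mk_mem_prod hS ht)
  have hc := (ContinuousLinearMap.toSpanSingletonCLE (𝕜 := ℝ) (E := ℝ)).continuous
  refine hasStrictFDerivAt_uncurry_coprod (u := (S, t)) (f := V)
    (f₁ := fun S t => ContinuousLinearMap.toSpanSingleton ℝ (p S t))
    (f₂ := fun S t => ContinuousLinearMap.toSpanSingleton ℝ (W S t)) ?_ ?_ ?_ ?_
  · filter_upwards [hn] with q hq using (hs.V_S q.1 hq.1 q.2 hq.2).hasFDerivAt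
  · filter_upwards [hn] with q hq using (hs.V_t q.1 hq.1 q.2 hq.2).hasFDerivAt
  · exact hc.continuousAt.comp (hp.continuousAt hn)
  · exact hc.continuousAt.comp (hW.continuousAt hn)

/-- Where `β` is constant, the equation is a transport equation. -/
lemma exp_mul_eq_of_const (hs : SeparateSolution r β V p h l W γ (Ioo c d) (Ioo u v))
    (hβ : Continuous β) (hh : ContinuousOn (uncurry h) (Ioo c d ×ˢ Ioo u v)) {S t t₀ a b k : ℝ}
    (ht : t ∈ Ioo a b) (ht₀ : t₀ ∈ Ioo a b)
    (hk : ∀ s ∈ Ioo a b, S * exp (-(r * (t - s))) ∈ Ioo c d ∧ s ∈ Ioo u v ∧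
      β (S * exp (-(r * (t - s))) * h (S * exp (-(r * (t - s)))) s) = k) :
    V S t = exp (r * (t - t₀)) * V (S * exp (-(r * (t - t₀)))) t₀ - S * k * (t - t₀) := by
  have hd : ∀ s ∈ Ioo a b, HasDerivAt (fun s => exp (r * (t - s)) *
      V (S * exp (-(r * (t - s)))) s + S * k * s) 0 s := by
    intro s hs'
    obtain ⟨h1, h2, h3⟩ := hk s hs'
    have e1 : HasDerivAt (fun s => exp (r * (t - s))) (exp (r * (t - s)) * (r * -1)) s :=
      (((hasDerivAt_id s).const_sub t).const_mul r).exp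
    have e2 : HasDerivAt (fun s => S * exp (-(r * (t - s))))
        (S * (exp (-(r * (t - s))) * -(r * -1))) s :=
      ((((hasDerivAt_id s).const_sub t).const_mul r).neg.exp).const_mul S
    have e3 := HasFDerivAt.comp_hasDerivAt (f := fun s => (S * exp (-(r * (t - s))), s)) s
      (hs.hasStrictFDerivAt_V hβ hh h1 h2).hasFDerivAt (e2.prodMk (hasDerivAt_id s))
    refine ((e1.mul e3).add ((hasDerivAt_id s).const_mul (S * k))).congr_deriv ?_
    have h4 := hs.pde _ h1 s h2
    rw [h3] at h4
    have h5 : exp (r * (t - s)) * exp (-(r * (t - s))) = 1 := by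
      rw [← exp_add, add_neg_cancel, exp_zero]
    simp only [ContinuousLinearMap.coprod_apply, ContinuousLinearMap.toSpanSingleton_apply,
      smul_eq_mul, h4, comp_apply, uncurry_apply_pair]
    linear_combination (-S * k) * h5
  have := eq_of_hasDerivAt_zero hd t ht t₀ ht₀
  simp only [sub_self, mul_zero, neg_zero, exp_zero, one_mul, mul_one] at this
  linear_combination this

lemma locallyDefectConstant_of_const
    (hs : SeparateSolution r β V p h l W γ (Ioo c d) (Ioo u v)) (hβ : ContDiff ℝ 2 β)
    (hh : ContinuousOn (uncurry h) (Ioo c d ×ˢ Ioo u v)) {S₀ t₀ : ℝ} (hS₀ : S₀ ∈ Ioo c d)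
    (ht₀ : t₀ ∈ Ioo u v) (hb : ∀ᶠ x in 𝓝 (S₀ * h S₀ t₀), deriv β x = 0) :
    LocallyDefectConstant h γ (Ioo c d) (Ioo u v) S₀ t₀ := by
  have hn : Ioo c d ×ˢ Ioo u v ∈ 𝓝 (S₀, t₀) :=
    (isOpen_Ioo.prod isOpen_Ioo).mem_nhds (mk_mem_prod hS₀ ht₀)
  set k := β (S₀ * h S₀ t₀) with hk
  have hbk : ∀ᶠ x in 𝓝 (S₀ * h S₀ t₀), β x = k := by
    obtain ⟨ε, hε, hε'⟩ := Metric.eventually_nhds_iff_ball.1 hb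
    rw [Real.ball_eq_Ioo] at hε'
    filter_upwards [Ioo_mem_nhds (sub_lt_self _ hε) (lt_add_of_pos_right _ hε)] with x hx
    exact eq_of_hasDerivAt_zero (fun y hy => by
      simpa [hε' y hy] using (hβ.differentiable (by norm_num) y).hasDerivAt) x hx _
      ⟨sub_lt_self _ hε, lt_add_of_pos_right _ hε⟩
  have hH : ContinuousAt (fun q : ℝ × ℝ => q.1 * h q.1 q.2) (S₀, t₀) :=
    continuousAt_fst.mul (hh.continuousAt hn)
  obtain ⟨ρ, hρ, hsub⟩ := exists_rect_subset (inter_mem (hH.eventually hbk) hn)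
  have hm : ContinuousAt (fun q : ℝ × ℝ => q.1 * exp (-(r * q.2))) (S₀, 0) := by fun_prop
  obtain ⟨ρ', hρ', hsub'⟩ := exists_rect_subset (hm.preimage_mem_nhds (t := Ioo (S₀ - ρ) (S₀ + ρ))
    (isOpen_Ioo.mem_nhds (by simpa using hρ)))
  set κ := min ρ (ρ' / 2) with hκ
  have hκ0 : 0 < κ := lt_min hρ (by linarith)
  have hκ1 : κ ≤ ρ := min_le_left _ _
  have hκ2 : κ ≤ ρ' / 2 := min_le_right _ _
  have hmem : ∀ S ∈ Ioo (S₀ - κ) (S₀ + κ), ∀ t ∈ Ioo (t₀ - κ) (t₀ + κ),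
      ∀ s ∈ Ioo (t₀ - κ) (t₀ + κ), S * exp (-(r * (t - s))) ∈ Ioo c d ∧ s ∈ Ioo u v ∧
      β (S * exp (-(r * (t - s))) * h (S * exp (-(r * (t - s)))) s) = k := by
    intro S hS t ht s hs'
    have h1 : S * exp (-(r * (t - s))) ∈ Ioo (S₀ - ρ) (S₀ + ρ) :=
      @hsub' (S, t - s) (mk_mem_prod ⟨by linarith [hS.1], by linarith [hS.2]⟩
        ⟨by linarith [hs'.2, ht.1], by linarith [hs'.1, ht.2]⟩)
    have h2 := @hsub (S * exp (-(r * (t - s))), s) (mk_mem_prod (Ioo_subset_Icc_self h1)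
      ⟨by linarith [hs'.1], by linarith [hs'.2]⟩)
    exact ⟨h2.2.1, h2.2.2, h2.1⟩
  have ht₀' : t₀ ∈ Ioo (t₀ - κ) (t₀ + κ) := ⟨by linarith, by linarith⟩
  have hV : ∀ S ∈ Ioo (S₀ - κ) (S₀ + κ), ∀ t ∈ Ioo (t₀ - κ) (t₀ + κ),
      V S t = exp (r * (t - t₀)) * V (S * exp (-(r * (t - t₀)))) t₀ - S * k * (t - t₀) :=
    fun S hS t ht => hs.exp_mul_eq_of_const hβ.continuous hh ht ht₀' (hmem S hS t ht)
  have hin : ∀ S ∈ Ioo (S₀ - κ) (S₀ + κ), ∀ t ∈ Ioo (t₀ - κ) (t₀ + κ),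
      S ∈ Ioo c d ∧ t ∈ Ioo u v := fun S hS t ht => by
    have := hmem S hS t ht t ht
    simp only [sub_self, mul_zero, neg_zero, exp_zero, mul_one] at this
    exact ⟨this.1, this.2.1⟩
  have hexp : ∀ t, exp (r * (t - t₀)) * exp (-(r * (t - t₀))) = 1 := fun t => by
    rw [← exp_add, add_neg_cancel, exp_zero]
  have hscale : ∀ (S t : ℝ), HasDerivAt (fun S => S * exp (-(r * (t - t₀))))
      (1 * exp (-(r * (t - t₀)))) S := fun S t => (hasDerivAt_id S).mul_const _
  have hp : ∀ S ∈ Ioo (S₀ - κ) (S₀ + κ), ∀ t ∈ Ioo (t₀ - κ) (t₀ + κ),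
      p S t = p (S * exp (-(r * (t - t₀)))) t₀ - k * (t - t₀) := by
    intro S hS t ht
    have h1 := (hs.V_S S (hin S hS t ht).1 t (hin S hS t ht).2)
    have h2 := (((hs.V_S _ (hmem S hS t ht t₀ ht₀').1 t₀ ht₀).comp S (hscale S t)).const_mul
      (exp (r * (t - t₀)))).sub (((hasDerivAt_id S).mul_const k).mul_const (t - t₀))
    have he : (fun S => V S t) =ᶠ[𝓝 S] _ :=
      Filter.mem_of_superset (isOpen_Ioo.mem_nhds hS) fun w hw => hV w hw t ht
    refine (h1.unique (h2.congr_of_eventuallyEq he)).trans ?_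
    linear_combination p (S * exp (-(r * (t - t₀)))) t₀ * hexp t
  have hhe : ∀ S ∈ Ioo (S₀ - κ) (S₀ + κ), ∀ t ∈ Ioo (t₀ - κ) (t₀ + κ),
      h S t = h (S * exp (-(r * (t - t₀)))) t₀ * exp (-(r * (t - t₀))) := by
    intro S hS t ht
    have h1 := (hs.p_S S (hin S hS t ht).1 t (hin S hS t ht).2)
    have h2 := ((hs.p_S _ (hmem S hS t ht t₀ ht₀').1 t₀ ht₀).comp S (hscale S t)).sub_const
      (k * (t - t₀))
    have he : (fun S => p S t) =ᶠ[𝓝 S] _ :=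
      Filter.mem_of_superset (isOpen_Ioo.mem_nhds hS) fun w hw => hp w hw t ht
    refine (h1.unique (h2.congr_of_eventuallyEq he)).trans ?_
    ring
  refine hs.locallyDefectConstant_of_differentiable hS₀ ht₀ ?_
  have hn' : Ioo (S₀ - κ) (S₀ + κ) ×ˢ Ioo (t₀ - κ) (t₀ + κ) ∈ 𝓝 (S₀, t₀) :=
    (isOpen_Ioo.prod isOpen_Ioo).mem_nhds (mk_mem_prod ⟨by linarith, by linarith⟩ ht₀')
  filter_upwards [hn'] with q hq
  have h1 : DifferentiableAt ℝ (fun t => q.1 * exp (-(r * (t - t₀)))) q.2 := by fun_prop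
  have h2 : DifferentiableAt ℝ (fun t => exp (-(r * (t - t₀)))) q.2 := by fun_prop
  have h3 := (hs.h_S _ (hmem q.1 hq.1 q.2 hq.2 t₀ ht₀').1 t₀ ht₀).differentiableAt
  have h4 := (DifferentiableAt.comp q.2 h3 h1).mul h2
  refine h4.congr_of_eventuallyEq ?_
  exact Filter.mem_of_superset (isOpen_Ioo.mem_nhds hq.2) fun w hw => hhe q.1 hq.1 w hw

end SeparateSolution

end

section

variable {r : ℝ} {β : ℝ → ℝ} {V p h l W γ : ℝ → ℝ → ℝ} {J I : Set ℝ} {c d u v : ℝ}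

namespace SeparateSolution

/-- If `h` is jointly continuous, then the second `S`-derivative of `∂ₜV` exists and is `γ`. -/
lemma hasDerivAt_flux
    (hs : SeparateSolution r β V p h l W γ (Ioo c d) (Ioo u v)) (hβ : ContDiff ℝ 2 β)
    (hh : ContinuousOn (uncurry h) (Ioo c d ×ˢ Ioo u v)) {S₀ t₀ : ℝ} (hS₀ : S₀ ∈ Ioo c d)
    (ht₀ : t₀ ∈ Ioo u v) : HasDerivAt (fun S => flux r β h l S t₀) (γ S₀ t₀) S₀ := by
  by_cases hγ : γ S₀ t₀ = 0
  swap
  · exact hs.hasDerivAt_flux_of_locally hβ (hs.locallyDefectConstant_of_ne_zero hS₀ ht₀ hγ)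
  by_cases ha₀ : deriv β (S₀ * h S₀ t₀) = 0
  swap
  · exact hs.hasDerivAt_flux_of_locally hβ (hs.defectConstant_of_nondegenerate hβ hh hS₀ ht₀ ha₀)
  by_cases hb : ∀ᶠ x in 𝓝 (S₀ * h S₀ t₀), deriv β x = 0
  · exact hs.hasDerivAt_flux_of_locally hβ (hs.locallyDefectConstant_of_const hβ hh hS₀ ht₀ hb)
  set H : ℝ → ℝ := fun S => S * h S t₀ with hHdef
  set H' : ℝ → ℝ := fun S => h S t₀ + S * l S t₀ with hH'def
  have hH : ∀ S ∈ Ioo c d, HasDerivAt H (H' S) S := fun S hS =>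
    ((hasDerivAt_id S).mul (hs.h_S S hS t₀ ht₀)).congr_deriv (by simp [hH'def])
  have hhc : ContinuousOn (fun S => h S t₀) (Ioo c d) := fun S hS =>
    (hs.h_S S hS t₀ ht₀).continuousAt.continuousWithinAt
  have hH'c : ContinuousOn H' (Ioo c d) :=
    hhc.add (continuousOn_id.mul (hs.l_cont t₀ ht₀))
  have hHc : ContinuousOn H (Ioo c d) := continuousOn_id.mul hhc
  have hn : Ioo c d ∈ 𝓝 S₀ := isOpen_Ioo.mem_nhds hS₀
  have hβ1 : ∀ x, HasDerivAt β (deriv β x) x :=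
    fun x => (hβ.differentiable (by norm_num) x).hasDerivAt
  have hβ2 : ContDiff ℝ 1 (deriv β) := ((contDiff_succ_iff_deriv (n := 1)).1 hβ).2.2
  set a : ℝ → ℝ := fun S => deriv β (H S) with ha
  have haS : HasDerivAt a (deriv (deriv β) (H S₀) * H' S₀) S₀ :=
    (hβ2.differentiable (by norm_num) _).hasDerivAt.comp S₀ (hH S₀ hS₀)
  have hac : ContinuousOn a (Ioo c d) := hβ2.continuous.comp_continuousOn hHc
  set Y : ℝ → ℝ := fun S => a S * (S * H' S) with hYdef
  have hYS : HasDerivAt Y (deriv (deriv β) (H S₀) * H' S₀ * (S₀ * H' S₀)) S₀ :=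
    hasDerivAt_mul_of_continuousAt haS ha₀ ((continuousOn_id.mul hH'c).continuousAt hn)
  have hflux : ∀ S, flux r β h l S t₀ = -β (H S) - Y S - r * H S := fun S => by
    simp only [flux, hYdef, hHdef, hH'def, ha]
    ring
  have hkey : deriv (deriv β) (H S₀) * H' S₀ * (S₀ * H' S₀) = -r * H' S₀ := by
    by_cases hH0 : H' S₀ = 0
    · rw [hH0]
      ring
    have hmap : map H (𝓝 S₀) = 𝓝 (H S₀) :=
      (hasStrictDerivAt_of_hasDerivAt_of_continuousAt
        (Filter.mem_of_superset hn hH) (hH'c.continuousAt hn)).map_nhds_eq hH0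
    have hfreq : ∃ᶠ S in 𝓝 S₀, a S ≠ 0 := by
      rw [Filter.Frequently]
      intro hcon
      refine hb ?_
      change ∀ᶠ x in 𝓝 (H S₀), deriv β x = 0
      rw [← hmap, eventually_map]
      exact hcon.mono fun S hS => not_not.1 hS
    have hγc : Continuous fun S => γ S t₀ := hs.γ_cont.comp (Continuous.prodMk_left t₀)
    refine (deriv_eq_of_zero_set (φ := fun S => -γ S t₀ - a S * H' S - r * H' S) hS₀ hYS
      (hac.mul (continuousOn_id.mul hH'c)) hac
      (((hγc.neg.continuousOn.sub (hac.mul hH'c)).sub (hH'c.const_mul r)).continuousAt hn)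
      (fun S _ h0 => by simp [hYdef, h0]) (fun S hS h0 => ?_) ha₀ hfreq).trans ?_
    · have h1 := hs.hasDerivAt_flux_of_locally hβ
        (hs.defectConstant_of_nondegenerate hβ hh hS ht₀ h0)
      refine (((h1.neg.sub ((hβ1 (H S)).comp S (hH S hS))).sub
        ((hH S hS).const_mul r)).congr_of_eventuallyEq (Eventually.of_forall fun x => ?_))
      simp only [Pi.sub_apply, Pi.neg_apply, comp_apply, hflux]
      ring
    · change -γ S₀ t₀ - deriv β (S₀ * h S₀ t₀) * H' S₀ - r * H' S₀ = _
      rw [hγ, ha₀]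
      ring
  simp only [hflux]
  refine ((((hβ1 (H S₀)).comp S₀ (hH S₀ hS₀)).neg.sub hYS).sub
    ((hH S₀ hS₀).const_mul r)).congr_deriv ?_
  rw [show deriv β (H S₀) = 0 from ha₀, hγ]
  linear_combination -hkey

lemma defectConstant_of_continuousOn
    (hs : SeparateSolution r β V p h l W γ (Ioo c d) (Ioo u v)) (hβ : ContDiff ℝ 2 β)
    (hh : ContinuousOn (uncurry h) (Ioo c d ×ˢ Ioo u v)) :
    DefectConstant h γ (Ioo c d) (Ioo u v) :=
  hs.defectConstant_of_hasDerivAt_flux hβ fun _ hS _ ht => hs.hasDerivAt_flux hβ hh hS ht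

end SeparateSolution

end

section

variable {r : ℝ} {β : ℝ → ℝ} {V p h l W γ : ℝ → ℝ → ℝ} {J I : Set ℝ} {c d u v : ℝ}

/-- The instants around which the defect is constant in time. -/
def goodTimes (h γ : ℝ → ℝ → ℝ) (J I : Set ℝ) : Set ℝ :=
  ⋃₀ {A | IsOpen A ∧ A ⊆ I ∧ DefectConstant h γ J A}

lemma isOpen_goodTimes : IsOpen (goodTimes h γ J I) := isOpen_sUnion fun _ hA => hA.1

lemma defectConstant_of_subset_goodTimes (hI : Ioo u v ⊆ goodTimes h γ J I) :
    DefectConstant h γ J (Ioo u v) := fun S hS => by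
  refine eq_of_hasDerivAt_zero fun t ht => ?_
  obtain ⟨A, ⟨hAo, -, hA⟩, htA⟩ := hI ht
  exact (hasDerivAt_const t (defect h γ S t)).congr_of_eventuallyEq
    (Filter.mem_of_superset (hAo.mem_nhds htA) fun s hs => hA S hS s hs t htA)

lemma forall_mem_closure_le {f g : ℝ → ℝ} {A : Set ℝ} {t : ℝ} (ht : t ∈ closure A)
    (hf : ContinuousAt f t) (hg : ContinuousAt g t) (h : ∀ s ∈ A, f s ≤ g s) : f t ≤ g t := by
  by_contra! hcon
  obtain ⟨s, h1, h2⟩ := ((mem_closure_iff_frequently.1 ht).and_eventually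
    (hg.eventually_lt hf hcon)).exists
  exact (h s h1).not_gt h2

namespace SeparateSolution

lemma continuousAt_reduced (hs : SeparateSolution r β V p h l W γ J I) {S t : ℝ} (hS : S ∈ J)
    (ht : t ∈ I) : ContinuousAt (reduced V γ S) t := (hs.hasDerivAt_reduced_t hS ht).continuousAt

lemma defectConstant_insert (hs : SeparateSolution r β V p h l W γ (Ioo c d) I) {A : Set ℝ}
    (hA : A ⊆ I) (hd : DefectConstant h γ (Ioo c d) A) {t e : ℝ} (ht : t ∈ A) (he : e ∈ I)
    (heA : e ∈ closure A) : ∀ S ∈ Ioo c d, defect h γ S e = defect h γ S t := by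
  have key : ∀ x ∈ Ioo c d, ∀ y ∈ Ioo c d, ∀ z ∈ Ioo c d,
      (reduced V γ x e - reduced V γ x t) * (z - y) =
        (reduced V γ y e - reduced V γ y t) * (z - x) +
        (reduced V γ z e - reduced V γ z t) * (x - y) := by
    intro x hx y hy z hz
    have haff : ∀ s ∈ A, (reduced V γ x s - reduced V γ x t) * (z - y) =
        (reduced V γ y s - reduced V γ y t) * (z - x) +
        (reduced V γ z s - reduced V γ z t) * (x - y) := fun s hs' =>
      affine_of_second_deriv_zero (c := c) (d := d)
        (f := fun S => reduced V γ S s - reduced V γ S t)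
        (fun w hw => (hs.hasDerivAt_reduced_S hw (hA hs')).sub
          (hs.hasDerivAt_reduced_S hw (hA ht)))
        (fun w hw => ((hs.hasDerivAt_reduced_SS hw (hA hs')).sub
          (hs.hasDerivAt_reduced_SS hw (hA ht))).congr_deriv
            (sub_eq_zero.2 (hd w hw s hs' t ht))) hx hy hz
    have hcx := hs.continuousAt_reduced hx he
    have hcy := hs.continuousAt_reduced hy he
    have hcz := hs.continuousAt_reduced hz he
    have h1 : ContinuousAt (fun s => (reduced V γ x s - reduced V γ x t) * (z - y)) e := by
      fun_prop
    have h2 : ContinuousAt (fun s => (reduced V γ y s - reduced V γ y t) * (z - x) +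
        (reduced V γ z s - reduced V γ z t) * (x - y)) e := by fun_prop
    exact le_antisymm (forall_mem_closure_le heA h1 h2 fun s hs' => (haff s hs').le)
      (forall_mem_closure_le heA h2 h1 fun s hs' => (haff s hs').ge)
  intro S hS
  exact sub_eq_zero.1 (second_deriv_zero_of_affine
    (fun w hw => (hs.hasDerivAt_reduced_S hw he).sub (hs.hasDerivAt_reduced_S hw (hA ht)))
    (fun w hw => (hs.hasDerivAt_reduced_SS hw he).sub (hs.hasDerivAt_reduced_SS hw (hA ht)))
    key S hS)

lemma defect_eq_of_Ioo_subset_goodTimes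
    (hs : SeparateSolution r β V p h l W γ (Ioo c d) I) {a b : ℝ} (hab : a < b)
    (hI : Icc a b ⊆ I) (hg : Ioo a b ⊆ goodTimes h γ (Ioo c d) I) :
    ∀ S ∈ Ioo c d, defect h γ S a = defect h γ S b := by
  intro S hS
  obtain ⟨t, ht⟩ := nonempty_Ioo.2 hab
  have hd := defectConstant_of_subset_goodTimes hg
  have hsub := Ioo_subset_Icc_self.trans hI
  have hcl : closure (Ioo a b) = Icc a b := closure_Ioo hab.ne
  rw [hs.defectConstant_insert hsub hd ht (hI (left_mem_Icc.2 hab.le))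
      (hcl ▸ left_mem_Icc.2 hab.le) S hS,
    hs.defectConstant_insert hsub hd ht (hI (right_mem_Icc.2 hab.le))
      (hcl ▸ right_mem_Icc.2 hab.le) S hS]

/-- A uniform Lipschitz bound on `h` in `S` passes to limits in `t`. -/
lemma lipschitz_of_mem_closure (hs : SeparateSolution r β V p h l W γ (Ioo c d) I) {A : Set ℝ}
    (hA : A ⊆ I) {K : ℝ}
    (hL : ∀ t ∈ A, ∀ x ∈ Ioo c d, ∀ y ∈ Ioo c d, |h x t - h y t| ≤ K * |x - y|) {t : ℝ}
    (ht : t ∈ I) (htA : t ∈ closure A) :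
    ∀ x ∈ Ioo c d, ∀ y ∈ Ioo c d, |h x t - h y t| ≤ K * |x - y| := by
  intro x hx y hy
  have hdiff : ∀ e > 0, Icc (x - e) (x + e) ⊆ Ioo c d → Icc (y - e) (y + e) ⊆ Ioo c d →
      |(V (x + e) t - 2 * V x t + V (x - e) t) - (V (y + e) t - 2 * V y t + V (y - e) t)| ≤
        e ^ 2 * (K * |x - y|) := by
    intro e he hxe hye
    have hV : ∀ z ∈ Ioo c d, ContinuousAt (V z) t := fun z hz => (hs.V_t z hz t ht).continuousAt
    have h1 := hV x hx
    have h2 := hV y hy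
    have h3 := hV _ (hxe (left_mem_Icc.2 (by linarith)))
    have h4 := hV _ (hxe (right_mem_Icc.2 (by linarith)))
    have h5 := hV _ (hye (left_mem_Icc.2 (by linarith)))
    have h6 := hV _ (hye (right_mem_Icc.2 (by linarith)))
    refine forall_mem_closure_le (f := fun t => |(V (x + e) t - 2 * V x t + V (x - e) t) -
      (V (y + e) t - 2 * V y t + V (y - e) t)|) htA (by fun_prop) continuousAt_const
      fun s hsA => ?_
    have hsI := hA hsA
    have hshift : ∀ z ∈ Icc (x - e) (x + e), z + (y - x) ∈ Ioo c d := fun z hz =>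
      hye ⟨by linarith [hz.1], by linarith [hz.2]⟩
    obtain ⟨ξ, hξ, heq⟩ := exists_second_difference_eq (f := fun z => V z s - V (z + (y - x)) s)
      (f' := fun z => p z s - p (z + (y - x)) s) (f'' := fun z => h z s - h (z + (y - x)) s)
      (x := x) he
      (fun z hz => (hs.V_S z (hxe hz) s hsI).sub
        ((hs.V_S _ (hshift z hz) s hsI).comp_add_const z (y - x)))
      (fun z hz => (hs.p_S z (hxe hz) s hsI).sub
        ((hs.p_S _ (hshift z hz) s hsI).comp_add_const z (y - x)))
    have hb := hL s hsA ξ (hxe (Ioo_subset_Icc_self hξ)) _ (hshift ξ (Ioo_subset_Icc_self hξ))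
    have e1 : (V (x + e) s - 2 * V x s + V (x - e) s) -
        (V (y + e) s - 2 * V y s + V (y - e) s) =
        e ^ 2 * (h ξ s - h (ξ + (y - x)) s) := by
      rw [← heq, show x + e + (y - x) = y + e by ring, show x + (y - x) = y by ring,
        show x - e + (y - x) = y - e by ring]
      ring
    simp only [e1, abs_mul, abs_of_nonneg (sq_nonneg e)]
    rw [show ξ - (ξ + (y - x)) = x - y by ring] at hb
    gcongr
  refine le_of_forall_pos_le_add fun η hη => ?_
  have hnear : ∀ z ∈ Ioo c d, ∀ᶠ e in 𝓝[>] (0:ℝ), Icc (z - e) (z + e) ⊆ Ioo c d ∧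
      ∀ w ∈ Icc (z - e) (z + e), |h w t - h z t| ≤ η / 2 := by
    intro z hz
    have h1 : ∀ᶠ w in 𝓝 z, w ∈ Ioo c d ∧ |h w t - h z t| ≤ η / 2 := by
      refine (isOpen_Ioo.eventually_mem hz).and ?_
      have h2 := (hs.h_S z hz t ht).continuousAt
      filter_upwards [Metric.continuousAt_iff'.1 h2 (η / 2) (by linarith)] with w hw
      exact (Real.dist_eq _ _ ▸ hw).le
    obtain ⟨κ, hκ, hκ'⟩ := Metric.eventually_nhds_iff.1 h1
    filter_upwards [Ioo_mem_nhdsGT hκ] with e he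
    have h3 : ∀ w ∈ Icc (z - e) (z + e), dist w z < κ := fun w hw => by
      rw [Real.dist_eq, abs_lt]
      exact ⟨by linarith [hw.1, he.2], by linarith [hw.2, he.2]⟩
    exact ⟨fun w hw => (hκ' (h3 w hw)).1, fun w hw => (hκ' (h3 w hw)).2⟩
  obtain ⟨e, ⟨⟨hx1, hx2⟩, hy1, hy2⟩, he⟩ :=
    (((hnear x hx).and (hnear y hy)).and self_mem_nhdsWithin).exists
  have he0 : 0 < e := he
  obtain ⟨ξ, hξ, e1⟩ := exists_second_difference_eq (f := fun z => V z t) (f' := fun z => p z t)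
    (f'' := fun z => h z t) he0 (fun z hz => hs.V_S z (hx1 hz) t ht)
    (fun z hz => hs.p_S z (hx1 hz) t ht)
  obtain ⟨ζ, hζ, e2⟩ := exists_second_difference_eq (f := fun z => V z t) (f' := fun z => p z t)
    (f'' := fun z => h z t) he0 (fun z hz => hs.V_S z (hy1 hz) t ht)
    (fun z hz => hs.p_S z (hy1 hz) t ht)
  have h1 := hdiff e he0 hx1 hy1
  rw [e1, e2, ← mul_sub, abs_mul, abs_of_nonneg (sq_nonneg e),
    mul_le_mul_iff_right₀ (by positivity)] at h1
  have h2 := hx2 ξ (Ioo_subset_Icc_self hξ)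
  have h3 := hy2 ζ (Ioo_subset_Icc_self hζ)
  rw [abs_le] at h1 h2 h3 ⊢
  constructor <;> linarith [h1.1, h1.2, h2.1, h2.2, h3.1, h3.2]

end SeparateSolution

end

section

variable {r : ℝ} {β : ℝ → ℝ} {V p h l W γ : ℝ → ℝ → ℝ} {J I : Set ℝ} {c d u v : ℝ}

lemma exists_forall_mem_Ioo_of_pointwise {N U : Set ℝ} {P : ℕ → ℝ → Prop} (hU : IsOpen U)
    (hN : IsLocallyClosed N) (hne : N.Nonempty) (hNU : N ⊆ U)
    (hP : ∀ t ∈ N, ∃ n, P n t) (hcl : ∀ n, ∀ t ∈ N, t ∈ closure {s ∈ N | P n s} → P n t) :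
    ∃ n, ∃ t ∈ N, ∃ ε > 0, Icc (t - ε) (t + ε) ⊆ U ∧ ∀ s ∈ N, s ∈ Ioo (t - ε) (t + ε) → P n s := by
  have := hN.locallyCompactSpace
  have := hne.to_subtype
  have hc : ∀ n, IsClosed {t : N | P n t} := by
    refine fun n => isClosed_of_closure_subset fun t ht => hcl n t t.2 ?_
    refine closure_mono ?_ (closure_subtype.1 ht)
    rintro _ ⟨s, hs, rfl⟩
    exact ⟨s.2, hs⟩
  obtain ⟨n, t, ht⟩ := nonempty_interior_of_iUnion_of_closed hc
    (eq_univ_of_forall fun t => mem_iUnion.2 (hP t t.2))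
  obtain ⟨O, hO, hOt⟩ := mem_nhds_subtype _ _ _ |>.1 (mem_interior_iff_mem_nhds.1 ht)
  obtain ⟨ε, hε, hb⟩ := Metric.nhds_basis_closedBall.mem_iff.1
    (Filter.inter_mem hO (hU.mem_nhds (hNU t.2)))
  rw [Real.closedBall_eq_Icc] at hb
  exact ⟨n, t, t.2, ε, hε, fun x hx => (hb hx).2,
    fun s hs hst => hOt (show (⟨s, hs⟩ : N) ∈ Subtype.val ⁻¹' O from
      (hb (Ioo_subset_Icc_self hst)).1)⟩

namespace SeparateSolution

/-- Every instant near a bad instant shares its defect with a bad instant at least as close. -/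
lemma exists_bad_time_defect_eq (hs : SeparateSolution r β V p h l W γ (Ioo c d) I)
    {t b : ℝ} (hb : b ∈ I \ goodTimes h γ (Ioo c d) I) (hbI : uIcc t b ⊆ I) :
    ∃ e ∈ I \ goodTimes h γ (Ioo c d) I, e ∈ uIcc t b ∧
      ∀ S ∈ Ioo c d, defect h γ S t = defect h γ S e := by
  set B := uIcc t b \ goodTimes h γ (Ioo c d) I with hB
  have hBc : IsCompact B := isCompact_uIcc.diff isOpen_goodTimes
  have hbB : b ∈ B := ⟨right_mem_uIcc, hb.2⟩
  obtain ⟨e, heB, hmin⟩ := hBc.exists_isMinOn ⟨b, hbB⟩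
    (f := fun e => |e - t|) (by fun_prop)
  refine ⟨e, ⟨hbI heB.1, heB.2⟩, heB.1, ?_⟩
  have hsub : uIcc t e ⊆ uIcc t b := uIcc_subset_uIcc_left heB.1
  have hgood : ∀ x ∈ uIcc t b, |x - t| < |e - t| → x ∈ goodTimes h γ (Ioo c d) I := by
    intro x hx hlt
    by_contra hcon
    exact hlt.not_ge (hmin ⟨hx, hcon⟩)
  rcases lt_trichotomy t e with hlt | rfl | hlt
  · rw [uIcc_of_le hlt.le] at hsub
    refine hs.defect_eq_of_Ioo_subset_goodTimes hlt (hsub.trans hbI) fun x hx =>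
      hgood x (hsub (Ioo_subset_Icc_self hx)) ?_
    rw [abs_of_pos (sub_pos.2 hx.1), abs_of_pos (sub_pos.2 hlt)]
    linarith [hx.2]
  · exact fun _ _ => rfl
  · rw [uIcc_of_ge hlt.le] at hsub
    refine fun S hS => (hs.defect_eq_of_Ioo_subset_goodTimes hlt (hsub.trans hbI) (fun x hx =>
      hgood x (hsub (Ioo_subset_Icc_self hx)) ?_) S hS).symm
    rw [abs_of_neg (sub_neg.2 hx.2), abs_of_neg (sub_neg.2 hlt)]
    linarith [hx.1]

/-- If every instant shares its defect with one at which `h` is `K`-Lipschitz in `S`, then `h` is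
jointly continuous. -/
lemma continuousOn_of_lipschitz_representatives
    (hs : SeparateSolution r β V p h l W γ (Ioo c d) I) (hI : I ⊆ Icc u v) {K : ℝ}
    (hK : 0 ≤ K)
    (hL : ∀ t ∈ I, ∃ e ∈ I, (∀ S ∈ Ioo c d, defect h γ S t = defect h γ S e) ∧
      ∀ x ∈ Ioo c d, ∀ y ∈ Ioo c d, |h x e - h y e| ≤ K * |x - y|) :
    ContinuousOn (uncurry h) (Ioo c d ×ˢ I) := by
  refine continuousOn_of_equicontinuous hs.V_S hs.p_S
    (fun S hS t ht => (hs.V_t S hS t ht).continuousAt.continuousWithinAt) fun ε hε => ?_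
  set G : ℝ → ℝ → ℝ := fun S t => ∫ τ in (0:ℝ)..t, γ S τ with hG
  have hu : UniformContinuousOn (uncurry G) (Icc c d ×ˢ Icc u v) :=
    (isCompact_Icc.prod isCompact_Icc).uniformContinuousOn_of_continuous
      (continuous_time_primitive hs.γ_cont).continuousOn
  obtain ⟨δ, hδ, hGδ⟩ := Metric.uniformContinuousOn_iff.1 hu (ε / 3) (by positivity)
  have hGd : ∀ t ∈ I, ∀ x ∈ Ioo c d, ∀ y ∈ Ioo c d, |x - y| < δ → |G x t - G y t| < ε / 3 := by
    intro t ht x hx y hy hxy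
    refine hGδ (x, t) ⟨Ioo_subset_Icc_self hx, hI ht⟩ (y, t) ⟨Ioo_subset_Icc_self hy, hI ht⟩ ?_
    simpa [Prod.dist_eq, Real.dist_eq, hδ] using hxy
  refine ⟨min δ (ε / (3 * (K + 1))), by positivity, fun t ht x hx y hy hxy => ?_⟩
  obtain ⟨e, he, hte, hLe⟩ := hL t ht
  have h1 := abs_lt.1 (hGd t ht x hx y hy (hxy.trans_le (min_le_left _ _)))
  have h2 := abs_lt.1 (hGd e he x hx y hy (hxy.trans_le (min_le_left _ _)))
  have h3 : K * |x - y| ≤ ε / 3 := by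
    have := hxy.trans_le (min_le_right _ _)
    rw [lt_div_iff₀ (by positivity)] at this
    nlinarith [abs_nonneg (x - y)]
  have h4 := abs_le.1 ((hLe x hx y hy).trans h3)
  have h5 : h x t - G x t = h x e - G x e := hte x hx
  have h6 : h y t - G y t = h y e - G y e := hte y hy
  rw [abs_le]
  constructor <;> linarith [h1.1, h1.2, h2.1, h2.2, h4.1, h4.2]

lemma subset_goodTimes_of_lipschitz
    (hs : SeparateSolution r β V p h l W γ (Ioo c d) (Ioo u v)) (hβ : ContDiff ℝ 2 β)
    (hLip : ∀ t ∈ Ioo u v, ∃ n : ℕ, ∀ x ∈ Ioo c d, ∀ y ∈ Ioo c d,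
      |h x t - h y t| ≤ n * |x - y|) :
    Ioo u v ⊆ goodTimes h γ (Ioo c d) (Ioo u v) := by
  set N := Ioo u v \ goodTimes h γ (Ioo c d) (Ioo u v) with hN
  rw [← sdiff_eq_empty, ← hN, ← not_nonempty_iff_eq_empty]
  intro hne
  obtain ⟨n, t, ht, ε, hε, hsub, hn⟩ := exists_forall_mem_Ioo_of_pointwise (N := N)
    (P := fun n t => ∀ x ∈ Ioo c d, ∀ y ∈ Ioo c d, |h x t - h y t| ≤ (n : ℝ) * |x - y|)
    isOpen_Ioo (isOpen_Ioo.isLocallyClosed.inter isOpen_goodTimes.isClosed_compl.isLocallyClosed)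
    hne sdiff_subset (fun t ht => hLip t ht.1)
    (fun n t ht hcl => hs.lipschitz_of_mem_closure (fun s hs' => hs'.1.1)
      (fun s hs' => hs'.2) ht.1 hcl)
  have hsub' : Ioo (t - ε) (t + ε) ⊆ Ioo u v := Ioo_subset_Icc_self.trans hsub
  have hmem : t ∈ Ioo (t - ε) (t + ε) := ⟨by linarith, by linarith⟩
  have hs' := hs.mono (Subset.refl (Ioo c d)) hsub'
  have hcont := hs'.continuousOn_of_lipschitz_representatives Ioo_subset_Icc_self
    n.cast_nonneg fun s hst => by
      have hu : uIcc s t ⊆ Ioo (t - ε) (t + ε) := ordConnected_Ioo.uIcc_subset hst hmem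
      obtain ⟨e, he, hes, hde⟩ := hs.exists_bad_time_defect_eq ht (hu.trans hsub')
      exact ⟨e, hu hes, hde, hn e he (hu hes)⟩
  exact ht.2 ⟨_, ⟨isOpen_Ioo, hsub', hs'.defectConstant_of_continuousOn hβ hcont⟩, hmem⟩

lemma hasDerivAt_flux_of_lipschitz
    (hs : SeparateSolution r β V p h l W γ (Ioo c d) (Ioo u v)) (hβ : ContDiff ℝ 2 β)
    (hLip : ∀ t ∈ Ioo u v, ∃ n : ℕ, ∀ x ∈ Ioo c d, ∀ y ∈ Ioo c d,
      |h x t - h y t| ≤ n * |x - y|) :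
    ∀ S ∈ Ioo c d, ∀ t ∈ Ioo u v, HasDerivAt (fun S => flux r β h l S t) (γ S t) S :=
  hs.hasDerivAt_flux_of_defectConstant hβ
    (defectConstant_of_subset_goodTimes (hs.subset_goodTimes_of_lipschitz hβ hLip))

end SeparateSolution

end

section

variable {r : ℝ} {β : ℝ → ℝ}

lemma hasDerivAt_iterate_of_contDiffOn {f : ℝ → ℝ} (hf : ContDiffOn ℝ 3 f (Ioi 0)) :
    (∀ S ∈ Ioi (0:ℝ), HasDerivAt f (deriv f S) S) ∧
    (∀ S ∈ Ioi (0:ℝ), HasDerivAt (deriv f) (deriv (deriv f) S) S) ∧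
    (∀ S ∈ Ioi (0:ℝ), HasDerivAt (deriv (deriv f)) (deriv (deriv (deriv f)) S) S) ∧
    ContinuousOn (deriv (deriv (deriv f))) (Ioi 0) := by
  have h1 : ContDiffOn ℝ 2 (deriv f) (Ioi 0) := hf.deriv_of_isOpen isOpen_Ioi (by norm_num)
  have h2 : ContDiffOn ℝ 1 (deriv (deriv f)) (Ioi 0) :=
    h1.deriv_of_isOpen isOpen_Ioi (by norm_num)
  have h3 : ContDiffOn ℝ 0 (deriv (deriv (deriv f))) (Ioi 0) :=
    h2.deriv_of_isOpen isOpen_Ioi (by norm_num)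
  have key : ∀ {k : ℝ → ℝ} {n : WithTop ℕ∞}, n ≠ 0 → ContDiffOn ℝ n k (Ioi 0) →
      ∀ S ∈ Ioi (0:ℝ), HasDerivAt k (deriv k S) S := fun hn hk S hS =>
    ((hk.differentiableOn hn).differentiableAt (Ioi_mem_nhds hS)).hasDerivAt
  exact ⟨key (by norm_num) hf, key (by norm_num) h1, key (by norm_num) h2, h3.continuousOn⟩

/-- The right-hand side of the Gamma equation, computed from the derivative of the flux. -/
lemma gamma_rhs_of_hasDerivAt_flux {E : ℝ} (hE : 0 < E) (hβ : ContDiff ℝ 2 β)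
    {h l : ℝ → ℝ → ℝ} {t : ℝ} (hh : ∀ S ∈ Ioi (0:ℝ), HasDerivAt (fun S => h S t) (l S t) S)
    {x g : ℝ} (hg : HasDerivAt (fun S => flux r β h l S t) g (E * exp x)) :
    deriv (deriv fun x => β (E * exp x * h (E * exp x) t)) x
      + deriv (fun x => β (E * exp x * h (E * exp x) t)) x
      + r * deriv (fun x => E * exp x * h (E * exp x) t) x = -(E * exp x * g) := by
  have hS : ∀ x, HasDerivAt (fun x => E * exp x) (E * exp x) x :=
    fun x => (Real.hasDerivAt_exp x).const_mul E
  have hH : ∀ x, HasDerivAt (fun x => E * exp x * h (E * exp x) t)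
      (E * exp x * (h (E * exp x) t + E * exp x * l (E * exp x) t)) x := fun x => by
    have := (hS x).mul ((hh (E * exp x) (by simp only [mem_Ioi]; positivity)).comp x (hS x))
    refine this.congr_deriv ?_
    simp only [comp_apply]
    ring
  have hB : ∀ x, HasDerivAt (fun x => β (E * exp x * h (E * exp x) t))
      (-flux r β h l (E * exp x) t - β (E * exp x * h (E * exp x) t)
        - r * (E * exp x * h (E * exp x) t)) x := fun x => by
    have hd : HasDerivAt β (deriv β (E * exp x * h (E * exp x) t))
        (E * exp x * h (E * exp x) t) :=
      (hβ.differentiable (by norm_num)).differentiableAt.hasDerivAt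
    refine (hd.comp x (hH x)).congr_deriv ?_
    unfold flux
    ring
  have hB' : deriv (fun x => β (E * exp x * h (E * exp x) t)) = fun x =>
      -flux r β h l (E * exp x) t - β (E * exp x * h (E * exp x) t)
        - r * (E * exp x * h (E * exp x) t) := funext fun x => (hB x).deriv
  have hB2 := (((hg.comp x (hS x)).neg.sub (hB x)).sub ((hH x).const_mul r)).deriv
  rw [(hH x).deriv, (hB x).deriv, hB']
  refine (congrArg (fun z => z + _ + _) hB2).trans ?_
  ring

end

end GammaEquation

open GammaEquation

/-- If `V` is a sufficiently smooth solution of the nonlinear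
Black–Scholes equation `∂_t V + S β(S ∂²_S V) + r S ∂_S V − r V = 0` on
`(0,∞) × (0,T)`, then the transformed function `H(x,τ) = S ∂²_S V(S,t)` with
`S = E e^x`, `t = T − τ`, solves the quasilinear Gamma equation
`∂_τ H = ∂²_x β(H) + ∂_x β(H) + r ∂_x H` on `ℝ × (0,T)`. -/
theorem gamma_equation_of_blackScholes
    (r T E : ℝ) (hT : 0 < T) (hE : 0 < E)
    (β : ℝ → ℝ) (hβ : ContDiff ℝ 2 β)
    (V : ℝ → ℝ → ℝ)
    -- V is C³ in S
    (hVS : ∀ t ∈ Set.Ioo (0:ℝ) T, ContDiffOn ℝ 3 (fun S => V S t) (Set.Ioi 0))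
    -- V is C¹ in t
    (hVt : ∀ S ∈ Set.Ioi (0:ℝ), ContDiffOn ℝ 1 (fun t => V S t) (Set.Ioo 0 T))
    -- the mixed derivative ∂_t ∂²_S V is continuous
    (hmix : ContinuousOn
      (fun p : ℝ × ℝ => deriv (fun t => deriv (deriv (fun S => V S t)) p.1) p.2)
      (Set.Ioi 0 ×ˢ Set.Ioo 0 T))
    -- V solves the nonlinear Black–Scholes equation
    (hPDE : ∀ S ∈ Set.Ioi (0:ℝ), ∀ t ∈ Set.Ioo (0:ℝ) T,
      deriv (fun t' => V S t') t + S * β (S * deriv (deriv (fun S' => V S' t)) S)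
        + r * S * deriv (fun S' => V S' t) S - r * V S t = 0)
    (H : ℝ → ℝ → ℝ)
    (hH : ∀ x τ, H x τ =
      (E * Real.exp x) * deriv (deriv (fun S' => V S' (T - τ))) (E * Real.exp x)) :
    ∀ x : ℝ, ∀ τ ∈ Set.Ioo (0:ℝ) T,
      deriv (fun τ' => H x τ') τ
        = deriv (deriv (fun x' => β (H x' τ))) x + deriv (fun x' => β (H x' τ)) x
          + r * deriv (fun x' => H x' τ) x := by
  intro x τ hτ
  set h : ℝ → ℝ → ℝ := fun S t => deriv (deriv fun S => V S t) S
  set l : ℝ → ℝ → ℝ := fun S t => deriv (deriv (deriv fun S => V S t)) S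
  have ht : T - τ ∈ Ioo 0 T := ⟨by linarith [hτ.2], by linarith [hτ.1]⟩
  have hS : 0 < E * exp x := by positivity
  have hreg := fun t ht => hasDerivAt_iterate_of_contDiffOn (hVS t ht)
  obtain ⟨ρ, hρ, hsub⟩ := exists_rect_subset
    ((isOpen_Ioi.prod isOpen_Ioo).mem_nhds (mk_mem_prod (mem_Ioi.2 hS) ht))
  set c := E * exp x - ρ
  set d := E * exp x + ρ
  set u := T - τ - ρ
  set v := T - τ + ρ
  have hSm : E * exp x ∈ Ioo c d := ⟨by linarith, by linarith⟩
  have htm : T - τ ∈ Ioo u v := ⟨by linarith, by linarith⟩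
  have hJ : Icc c d ⊆ Ioi 0 := fun S hS' => (hsub (mk_mem_prod hS' (Ioo_subset_Icc_self htm))).1
  have hI : Icc u v ⊆ Ioo 0 T := fun t ht' => (hsub (mk_mem_prod (Ioo_subset_Icc_self hSm) ht')).2
  obtain ⟨γ, hγ, hγeq⟩ := exists_continuous_extension (a := c) (b := d) (c := u) (d := v)
    (by linarith) (by linarith) (g := fun S t => deriv (h S) t) (hmix.mono hsub)
  have hJ' := Ioo_subset_Icc_self.trans hJ
  have hI' := Ioo_subset_Icc_self.trans hI
  have hs : SeparateSolution r β V (fun S t => deriv (fun S => V S t) S) h l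
      (fun S t => deriv (V S) t) γ (Ioo c d) (Ioo u v) :=
    { pos := fun S hS => hJ' hS
      V_S := fun S hS t ht => (hreg t (hI' ht)).1 S (hJ' hS)
      p_S := fun S hS t ht => (hreg t (hI' ht)).2.1 S (hJ' hS)
      h_S := fun S hS t ht => (hreg t (hI' ht)).2.2.1 S (hJ' hS)
      l_cont := fun t ht => (hreg t (hI' ht)).2.2.2.mono hJ'
      V_t := fun S hS t ht => (((hVt S (hJ' hS)).differentiableOn (by norm_num)).differentiableAt
        (isOpen_Ioo.mem_nhds (hI' ht))).hasDerivAt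
      γ_cont := hγ
      γ_eq := fun S hS t ht =>
        (hγeq S (Ioo_subset_Icc_self hS) t (Ioo_subset_Icc_self ht)).symm
      pde := fun S hS t ht => by linear_combination hPDE S (hJ' hS) t (hI' ht) }
  have hLip : ∀ t ∈ Ioo u v, ∃ n : ℕ, ∀ x ∈ Ioo c d, ∀ y ∈ Ioo c d,
      |h x t - h y t| ≤ n * |x - y| := by
    intro t ht
    obtain ⟨C, hC⟩ := isCompact_Icc.exists_bound_of_continuousOn
      ((hreg t (hI' ht)).2.2.2.mono hJ)
    obtain ⟨n, hn⟩ := exists_nat_ge C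
    exact ⟨n, fun x hx y hy => (convex_Ioo c d).norm_image_sub_le_of_norm_hasDerivWithin_le
      (f := fun S => h S t) (fun S hS => (hs.h_S S hS t ht).hasDerivWithinAt)
      (fun S hS => (hC S (Ioo_subset_Icc_self hS)).trans hn) hy hx⟩
  have hflux := hs.hasDerivAt_flux_of_lipschitz hβ hLip _ hSm _ htm
  have hrhs := gamma_rhs_of_hasDerivAt_flux (h := h) (l := l) hE hβ (hreg _ ht).2.2.1 hflux
  rw [hγeq _ (Ioo_subset_Icc_self hSm) _ (Ioo_subset_Icc_self htm)] at hrhs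
  have hlhs : deriv (fun τ' => H x τ') τ = -(E * exp x * deriv (h (E * exp x)) (T - τ)) := by
    rw [show (fun τ' => H x τ') = fun τ' => E * exp x * h (E * exp x) (T - τ') from
      funext (hH x), deriv_const_mul_field, deriv_comp_const_sub (h (E * exp x)), mul_neg]
  rw [hlhs, ← hrhs]
  simp only [hH, h]
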